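/- arXiv:1505.07700 — 7 statements merged into one kernel-verified Lean document; each statement's English description precedes it below -/
import Mathlib

section
/- Let d ≥ 2 and let D ⊆ ℝ^d be a nonempty open set. Suppose V : [0,∞) → [0,∞) is nondecreasing, V(0)=0, V(r) > 0 for r > 0, and V(λr) ≤ λ V(r) for all λ ≥ 1, r ≥ 0. Define U(s) = V(s)²/s^d and H(x,y) = U(|x−y|) · V(δ_D(x)) V(δ_D(y)) / V(r(x,y))². Then for all pairwise distinct x, y, z ∈ D one has the 3G inequality H(x,z) H(z,y) / H(x,y) ≤ 9·2^d · V(δ_D(z)) · max( H(x,z)/V(δ_D(x)) , H(z,y)/V(δ_D(y)) ). -/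
open Metric MeasureTheory Filter Set

noncomputable section

/-- `δ_D(x)`: the distance from `x` to the complement of `D`. -/
def deltaD {d : ℕ} (D : Set (EuclideanSpace ℝ (Fin d)))
    (x : EuclideanSpace ℝ (Fin d)) : ℝ :=
  Metric.infDist x Dᶜ

/-- `r(y,z) = max(δ_D(y), δ_D(z), |y − z|)`. -/
def rD {d : ℕ} (D : Set (EuclideanSpace ℝ (Fin d)))
    (y z : EuclideanSpace ℝ (Fin d)) : ℝ :=
  max (max (deltaD D y) (deltaD D z)) (dist y z)

/-- `U(s) = V(s)² / s^d`. -/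
def Ufun (d : ℕ) (V : ℝ → ℝ) (s : ℝ) : ℝ :=
  (V s) ^ 2 / s ^ d

/-- `H(x,y) = U(|x−y|) · V(δ_D(x)) V(δ_D(y)) / V(r(x,y))²`. -/
def Hfun {d : ℕ} (V : ℝ → ℝ) (D : Set (EuclideanSpace ℝ (Fin d)))
    (x y : EuclideanSpace ℝ (Fin d)) : ℝ :=
  Ufun d V (dist x y) * (V (deltaD D x) * V (deltaD D y)) / (V (rD D x y)) ^ 2

theorem G_le_aux {d : ℕ} (hd : 2 ≤ d)
    (D : Set (EuclideanSpace ℝ (Fin d)))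
    (V : ℝ → ℝ)
    (hVmono : ∀ r s : ℝ, 0 ≤ r → r ≤ s → V r ≤ V s)
    (hVpos : ∀ r : ℝ, 0 < r → 0 < V r)
    (hVscal : ∀ lam r : ℝ, 1 ≤ lam → 0 ≤ r → V (lam * r) ≤ lam * V r)
    (p q w : EuclideanSpace ℝ (Fin d)) (hpq : p ≠ q) (hwq : w ≠ q)
    (h : dist p q ≤ 2 * dist w q) :
    Ufun d V (dist w q) / (V (rD D w q)) ^ 2 ≤
      9 * 2 ^ d * (Ufun d V (dist p q) / (V (rD D p q)) ^ 2) := by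
  have hr : rD D p q ≤ 3 * rD D w q := by
    have h1 : deltaD D p ≤ deltaD D q + dist p q := Metric.infDist_le_infDist_add_dist
    have h2 : deltaD D q ≤ rD D w q := le_trans (le_max_right _ _) (le_max_left _ _)
    have h3 : dist w q ≤ rD D w q := le_max_right _ _
    have h4 : 0 < dist w q := dist_pos.2 hwq
    refine max_le (max_le ?_ ?_) ?_ <;> linarith
  have hc : 0 < dist p q := dist_pos.2 hpq
  have hb : 0 < dist w q := dist_pos.2 hwq
  have hR1 : 0 < rD D p q := lt_of_lt_of_le hc (le_max_right _ _)
  have hR2 : 0 < rD D w q := lt_of_lt_of_le hb (le_max_right _ _)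
  generalize rD D p q = R1 at *
  generalize rD D w q = R2 at *
  generalize dist p q = c at *
  generalize dist w q = b at *
  have hVR : V R1 ≤ 3 * V R2 :=
    (hVmono _ _ hR1.le hr).trans (hVscal 3 R2 (by norm_num) hR2.le)
  have v1 := hVpos _ hR1
  have v2 := hVpos _ hR2
  have vb := hVpos _ hb
  have vc := hVpos _ hc
  have hVR2 : (V R1) ^ 2 ≤ 9 * (V R2) ^ 2 := by nlinarith
  have key : V b ^ 2 * c ^ d ≤ 2 ^ d * (V c ^ 2 * b ^ d) := by
    rcases le_total c b with hcb | hbc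
    · have s := hVscal (b / c) c ((one_le_div hc).2 hcb) hc.le
      rw [div_mul_cancel₀ _ hc.ne'] at s
      have s' : c * V b ≤ b * V c := by
        rw [div_mul_eq_mul_div, le_div_iff₀ hc] at s
        linarith
      obtain ⟨k, rfl⟩ := Nat.exists_eq_add_of_le hd
      have e1 : c ^ k ≤ b ^ k := pow_le_pow_left₀ hc.le hcb k
      have e2 : (c * V b) ^ 2 ≤ (b * V c) ^ 2 := pow_le_pow_left₀ (by positivity) s' 2
      have e3 : c ^ k * (c * V b) ^ 2 ≤ b ^ k * (b * V c) ^ 2 := by gcongr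
      have e4 : (1 : ℝ) ≤ 2 ^ (2 + k) := one_le_pow₀ (by norm_num)
      calc V b ^ 2 * c ^ (2 + k) = c ^ k * (c * V b) ^ 2 := by ring
        _ ≤ b ^ k * (b * V c) ^ 2 := e3
        _ = 1 * (V c ^ 2 * b ^ (2 + k)) := by ring
        _ ≤ _ := by gcongr
    · have e1 : V b ≤ V c := hVmono _ _ hb.le hbc
      calc V b ^ 2 * c ^ d ≤ V c ^ 2 * (2 * b) ^ d := by gcongr
        _ = _ := by rw [mul_pow]; ring
  unfold Ufun
  rw [div_div, div_div, mul_div_assoc', div_le_div_iff₀ (by positivity) (by positivity)]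
  calc V b ^ 2 * (c ^ d * V R1 ^ 2) = (V b ^ 2 * c ^ d) * V R1 ^ 2 := by ring
    _ ≤ (2 ^ d * (V c ^ 2 * b ^ d)) * (9 * V R2 ^ 2) := by gcongr
    _ = _ := by ring

theorem rD_comm_aux {d : ℕ} (D : Set (EuclideanSpace ℝ (Fin d)))
    (x y : EuclideanSpace ℝ (Fin d)) : rD D x y = rD D y x := by
  unfold rD
  rw [max_comm (deltaD D x), dist_comm]

/-- 3G inequality for the explicit Green function bound `H`. -/
theorem threeG_inequality {d : ℕ} (hd : 2 ≤ d)
    (D : Set (EuclideanSpace ℝ (Fin d))) (hDne : D.Nonempty) (hDopen : IsOpen D)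
    (V : ℝ → ℝ)
    (hVmono : ∀ r s : ℝ, 0 ≤ r → r ≤ s → V r ≤ V s)
    (hV0 : V 0 = 0)
    (hVpos : ∀ r : ℝ, 0 < r → 0 < V r)
    (hVscal : ∀ lam r : ℝ, 1 ≤ lam → 0 ≤ r → V (lam * r) ≤ lam * V r)
    (x y z : EuclideanSpace ℝ (Fin d)) (hx : x ∈ D) (hy : y ∈ D) (hz : z ∈ D)
    (hxy : x ≠ y) (hxz : x ≠ z) (hyz : y ≠ z) :
    Hfun V D x z * Hfun V D z y / Hfun V D x y ≤
      9 * 2 ^ d * V (deltaD D z) *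
        max (Hfun V D x z / V (deltaD D x)) (Hfun V D z y / V (deltaD D y)) := by
  have hVd : ∀ p, 0 ≤ V (deltaD D p) := fun p => by
    have := hVmono 0 (deltaD D p) le_rfl Metric.infDist_nonneg
    rwa [hV0] at this
  by_cases hne : (Dᶜ).Nonempty
  swap
  · have h0 : ∀ p, deltaD D p = 0 := fun p => by
      unfold deltaD
      rw [Set.not_nonempty_iff_eq_empty.1 hne, Metric.infDist_empty]
    simp [Hfun, h0, hV0]
  have hpos : ∀ p ∈ D, 0 < V (deltaD D p) := fun p hp =>
    hVpos _ ((hDopen.isClosed_compl.notMem_iff_infDist_pos hne).1 (by simpa using hp))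
  have vx := hpos x hx
  have vy := hpos y hy
  have vz := hpos z hz
  have gpos : ∀ p q, p ≠ q → 0 < Ufun d V (dist p q) / (V (rD D p q)) ^ 2 := fun p q h => by
    have h1 : 0 < dist p q := dist_pos.2 h
    have h2 := hVpos _ h1
    have h3 := hVpos (rD D p q) (lt_of_lt_of_le h1 (le_max_right _ _))
    unfold Ufun
    positivity
  have hA := gpos x z hxz
  have hB := gpos z y hyz.symm
  have hC := gpos x y hxy
  have hH : ∀ p q, Hfun V D p q = Ufun d V (dist p q) / (V (rD D p q)) ^ 2 *
      (V (deltaD D p) * V (deltaD D q)) := fun p q => by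
    unfold Hfun; ring
  have hmin : Ufun d V (dist x z) / (V (rD D x z)) ^ 2 ≤
        9 * 2 ^ d * (Ufun d V (dist x y) / (V (rD D x y)) ^ 2) ∨
      Ufun d V (dist z y) / (V (rD D z y)) ^ 2 ≤
        9 * 2 ^ d * (Ufun d V (dist x y) / (V (rD D x y)) ^ 2) := by
    have tri := dist_triangle x z y
    rcases le_total (dist x z) (dist z y) with h | h
    · right
      exact G_le_aux hd D V hVmono hVpos hVscal x y z hxy hyz.symm (by linarith)
    · left
      have := G_le_aux hd D V hVmono hVpos hVscal y x z hxy.symm hxz.symm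
        (by rw [dist_comm y x, dist_comm z x]; linarith)
      rwa [dist_comm y x, dist_comm z x, rD_comm_aux D y x, rD_comm_aux D z x] at this
  rw [hH, hH, hH]
  generalize Ufun d V (dist x z) / (V (rD D x z)) ^ 2 = A at *
  generalize Ufun d V (dist z y) / (V (rD D z y)) ^ 2 = B at *
  generalize Ufun d V (dist x y) / (V (rD D x y)) ^ 2 = C at *
  generalize V (deltaD D x) = X at *
  generalize V (deltaD D y) = Y at *
  generalize V (deltaD D z) = Z at *
  have e1 : A * (X * Z) * (B * (Z * Y)) / (C * (X * Y)) = Z * (Z * (A * B / C)) := by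
    field_simp
  have e2 : A * (X * Z) / X = Z * A := by field_simp
  have e3 : B * (Z * Y) / Y = Z * B := by field_simp
  rw [e1, e2, e3]
  have main : A * B / C ≤ 9 * 2 ^ d * max A B := by
    rw [div_le_iff₀ hC]
    rcases hmin with h | h
    · calc A * B ≤ (9 * 2 ^ d * C) * max A B := by
            gcongr
            exact le_max_right _ _
        _ = _ := by ring
    · calc A * B ≤ max A B * (9 * 2 ^ d * C) := by
            gcongr
            exact le_max_left _ _
        _ = _ := by ring
  rw [← mul_max_of_nonneg _ _ vz.le]
  calc Z * (Z * (A * B / C)) ≤ Z * (Z * (9 * 2 ^ d * max A B)) := by gcongr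
    _ = _ := by ring

end
end

section
/- Let D ⊆ ℝ^d be a nonempty open set and let V : [0,∞) → [0,∞) be nondecreasing with V(0)=0, V(r) > 0 for r > 0, and V(λr) ≤ λ V(r) for all λ ≥ 1, r ≥ 0. Then for all y, z ∈ D with y ≠ z: (1/4) · min( V(δ_D(y)) V(δ_D(z)) / V(|y−z|)² , 1 ) ≤ V(δ_D(y)) V(δ_D(z)) / V(r(y,z))² ≤ min( V(δ_D(y)) V(δ_D(z)) / V(|y−z|)² , 1 ). -/
open Metric MeasureTheory Filter Set

noncomputable section

/-- The factor `V(δ_D(y))V(δ_D(z))/V(r(y,z))²` is comparable with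
`min(V(δ_D(y))V(δ_D(z))/V(|y−z|)², 1)`. -/
theorem boundary_factor_comparable {d : ℕ}
    (D : Set (EuclideanSpace ℝ (Fin d))) (hDne : D.Nonempty) (hDopen : IsOpen D)
    (V : ℝ → ℝ)
    (hVmono : ∀ r s : ℝ, 0 ≤ r → r ≤ s → V r ≤ V s)
    (hV0 : V 0 = 0)
    (hVpos : ∀ r : ℝ, 0 < r → 0 < V r)
    (hVscal : ∀ lam r : ℝ, 1 ≤ lam → 0 ≤ r → V (lam * r) ≤ lam * V r)
    (y z : EuclideanSpace ℝ (Fin d)) (hy : y ∈ D) (hz : z ∈ D) (hyz : y ≠ z) :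
    (1 / 4) * min (V (deltaD D y) * V (deltaD D z) / (V (dist y z)) ^ 2) 1 ≤
        V (deltaD D y) * V (deltaD D z) / (V (rD D y z)) ^ 2 ∧
      V (deltaD D y) * V (deltaD D z) / (V (rD D y z)) ^ 2 ≤
        min (V (deltaD D y) * V (deltaD D z) / (V (dist y z)) ^ 2) 1 := by
  have ha : 0 ≤ deltaD D y := Metric.infDist_nonneg
  have hb : 0 ≤ deltaD D z := Metric.infDist_nonneg
  have h1 : deltaD D y ≤ deltaD D z + dist y z := Metric.infDist_le_infDist_add_dist
  have h2 : deltaD D z ≤ deltaD D y + dist y z := by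
    rw [dist_comm]; exact Metric.infDist_le_infDist_add_dist
  have ht : 0 < dist y z := dist_pos.mpr hyz
  have haR : deltaD D y ≤ rD D y z := le_trans (le_max_left _ _) (le_max_left _ _)
  have hbR : deltaD D z ≤ rD D y z := le_trans (le_max_right _ _) (le_max_left _ _)
  have htR : dist y z ≤ rD D y z := le_max_right _ _
  have hR : rD D y z = deltaD D y ∨ rD D y z = deltaD D z ∨ rD D y z = dist y z := by
    unfold rD
    rcases max_choice (max (deltaD D y) (deltaD D z)) (dist y z) with h | h
    · rw [h]
      rcases max_choice (deltaD D y) (deltaD D z) with h | h <;> simp [h]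
    · simp [h]
  generalize deltaD D y = a at *
  generalize deltaD D z = b at *
  generalize dist y z = t at *
  generalize rD D y z = R at *
  have hVa : 0 ≤ V a := hV0 ▸ hVmono 0 a le_rfl ha
  have hVb : 0 ≤ V b := hV0 ▸ hVmono 0 b le_rfl hb
  have hVt := hVpos t ht
  have hVaR := hVmono a R ha haR
  have hVbR := hVmono b R hb hbR
  have hVtR := hVmono t R ht.le htR
  have hVR : 0 < V R := hVt.trans_le hVtR
  have dbl : ∀ s, 0 ≤ s → R ≤ 2 * s → V R ≤ 2 * V s := fun s hs h =>
    (hVmono R _ (ht.le.trans htR) h).trans (hVscal 2 s (by norm_num) hs)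
  have key : V R ≤ 2 * V t ∨ (V R) ^ 2 ≤ 4 * (V a * V b) := by
    rcases hR with h | h | h
    · by_cases hc : R ≤ 2 * b
      · right
        have := dbl b hb hc
        rw [h] at *
        nlinarith
      · left
        exact dbl t ht.le (by linarith)
    · by_cases hc : R ≤ 2 * a
      · right
        have := dbl a ha hc
        rw [h] at *
        nlinarith
      · left
        exact dbl t ht.le (by linarith)
    · left
      exact dbl t ht.le (by linarith)
  have hP : 0 ≤ V a * V b := mul_nonneg hVa hVb
  refine ⟨?_, le_min ?_ ?_⟩
  · rcases key with h | h
    · refine (mul_le_mul_of_nonneg_left (min_le_left _ _) (by norm_num)).trans ?_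
      have h4 : (V R) ^ 2 ≤ 4 * (V t) ^ 2 := by nlinarith
      calc (1 / 4) * (V a * V b / (V t) ^ 2) = V a * V b / (4 * (V t) ^ 2) := by
            field_simp
        _ ≤ _ := div_le_div_of_nonneg_left hP (by positivity) h4
    · refine (mul_le_mul_of_nonneg_left (min_le_right _ _) (by norm_num)).trans ?_
      rw [le_div_iff₀ (by positivity)]
      linarith
  · exact div_le_div_of_nonneg_left hP (by positivity) (by gcongr)
  · rw [div_le_one (by positivity), sq]
    exact mul_le_mul hVaR hVbR hVb hVR.le

end
end

section
/- Let d ≥ 2 and let D ⊆ ℝ^d be a nonempty bounded open set which is C^{1,1}: there exists r₀ > 0 such that for every Q ∈ ∂D there are points x', x'' ∈ ℝ^d with B(x', r₀) ⊆ D, B(x'', r₀) ⊆ D^c and |x' − Q| = |x'' − Q| = r₀. Let V : [0,∞) → [0,∞) be nondecreasing with V(0)=0, V(r) > 0 for r > 0, V(λr) ≤ λ V(r) for all λ ≥ 1, and suppose there are constants c₂ ≥ 1 and α₁ ∈ (1,2) with V(ηr) ≤ c₂ η^{α₁/2} V(r) for all 0 < η ≤ 1 and 0 < r ≤ diam(D),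 and constants C̄₂ ≥ 1 and ᾱ ∈ (0,2) with V(λr) ≤ C̄₂ λ^{ᾱ/2} V(r) for all λ ≥ 1 and r > 0. Let b : ℝ^d → ℝ^d be measurable and belong to the Kato class, i.e. lim_{r→0⁺} sup_{x∈ℝ^d} ∫_{B(x,r)} V(|x−z|)²/|x−z|^{d+1} · |b(z)| dz = 0. Define H(y,z) = U(|y−z|) · ( V(δ_D(y)) V(δ_D(z)) / V(r(y,z))² ) · ( (δ_D(z) ∨ |y−z|) / (|y−z| δ_D(z)) ) for y ≠ z in D, where U(s) = V(s)²/s^d. Then lim_{R→∞} sup_{y∈D} ∫_{{z∈D : H(y,z) > R}} H(y,z) |b(z)| dz = 0; in particular H(y,·) is uniformly in y integrable against |b(z)| dz. -/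
open Metric MeasureTheory Filter Set

noncomputable section

/-- `H(y,z) = U(|y−z|) · (V(δ_D(y))V(δ_D(z))/V(r(y,z))²) · ((δ_D(z) ∨ |y−z|)/(|y−z| δ_D(z)))`. -/
def HQfun {d : ℕ} (V : ℝ → ℝ) (D : Set (EuclideanSpace ℝ (Fin d)))
    (y z : EuclideanSpace ℝ (Fin d)) : ℝ :=
  Ufun d V (dist y z) * (V (deltaD D y) * V (deltaD D z) / (V (rD D y z)) ^ 2) *
    (max (deltaD D z) (dist y z) / (dist y z * deltaD D z))

lemma normal_vec {E : Type*} [NormedAddCommGroup E] [InnerProductSpace ℝ E] (D : Set E)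
    (r₀ : ℝ) (hr₀ : 0 < r₀) (Q x' x'' : E)
    (h1 : ball x' r₀ ⊆ D) (h2 : ball x'' r₀ ⊆ Dᶜ) (h3 : dist x' Q = r₀) (h4 : dist x'' Q = r₀) :
    ∃ a : E, ‖a‖ = r₀ ∧ ball (Q + a) r₀ ⊆ D ∧ ball (Q - a) r₀ ⊆ Dᶜ := by
  have hdis : Disjoint (ball x' r₀) (ball x'' r₀) :=
    Disjoint.mono h1 h2 disjoint_compl_right
  have h5 := (disjoint_ball_ball_iff hr₀ hr₀).1 hdis
  rw [dist_eq_norm] at h3 h4 h5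
  have h6 : ‖(x' - Q) + (x'' - Q)‖ = 0 := by
    have := parallelogram_law_with_norm ℝ (x' - Q) (x'' - Q)
    have e : (x' - Q) - (x'' - Q) = x' - x'' := by abel
    rw [e, h3, h4] at this
    have h7 := norm_nonneg ((x' - Q) + (x'' - Q))
    nlinarith
  rw [norm_eq_zero] at h6
  refine ⟨x' - Q, h3, ?_, ?_⟩
  · rw [add_sub_cancel]; exact h1
  · have : Q - (x' - Q) = x'' := by
      have := eq_neg_of_add_eq_zero_left h6
      rw [this]; abel
    rw [this]; exact h2

lemma two_pts {E : Type*} [NormedAddCommGroup E] [InnerProductSpace ℝ E] (D : Set E)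
    (hD : IsOpen D) (r₀ : ℝ) (hr₀ : 0 < r₀) (Q Q' Q0 a' a0 : E)
    (hQ : Q ∈ frontier D)
    (na' : ‖a'‖ = r₀) (h1 : ball (Q' + a') r₀ ⊆ D) (h2 : ball (Q' - a') r₀ ⊆ Dᶜ)
    (na0 : ‖a0‖ = r₀) (h3 : ball (Q0 + a0) r₀ ⊆ D) (h4 : ball (Q0 - a0) r₀ ⊆ Dᶜ) :
    |inner ℝ (Q - Q') a0| ≤ ‖Q - Q'‖ ^ 2 / 2 + ‖Q - Q'‖ * ‖Q' - Q0‖ := by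
  have hA : ‖a0 - a'‖ ≤ ‖Q' - Q0‖ := by
    have d1 : Disjoint (ball (Q' + a') r₀) (ball (Q0 - a0) r₀) :=
      Disjoint.mono h1 h4 disjoint_compl_right
    have d2 : Disjoint (ball (Q0 + a0) r₀) (ball (Q' - a') r₀) :=
      Disjoint.mono h3 h2 disjoint_compl_right
    have e1 := (disjoint_ball_ball_iff hr₀ hr₀).1 d1
    have e2 := (disjoint_ball_ball_iff hr₀ hr₀).1 d2
    rw [dist_eq_norm] at e1 e2
    have p1 : Q' + a' - (Q0 - a0) = (a0 + a') + (Q' - Q0) := by abel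
    have p2 : Q0 + a0 - (Q' - a') = (a0 + a') - (Q' - Q0) := by abel
    rw [p1] at e1
    rw [p2] at e2
    have q1 := parallelogram_law_with_norm ℝ (a0 + a') (Q' - Q0)
    have q2 := parallelogram_law_with_norm ℝ a0 a'
    rw [na0, na'] at q2
    refine abs_le_of_sq_le_sq' ?_ (norm_nonneg _) |>.2
    nlinarith
  have hB : |inner ℝ (Q - Q') a'| ≤ ‖Q - Q'‖ ^ 2 / 2 := by
    have f1 : Q ∉ ball (Q' + a') r₀ := fun h => by
      rw [hD.frontier_eq] at hQ
      exact hQ.2 (h1 h)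
    have f2 : Q ∉ ball (Q' - a') r₀ := fun h => by
      have : Q ∈ interior Dᶜ := interior_maximal h2 isOpen_ball h
      rw [interior_compl] at this
      exact this (frontier_subset_closure hQ)
    rw [mem_ball, dist_eq_norm, not_lt] at f1 f2
    have p1 : Q - (Q' + a') = (Q - Q') - a' := by abel
    have p2 : Q - (Q' - a') = (Q - Q') + a' := by abel
    rw [p1] at f1
    rw [p2] at f2
    have q1 := norm_sub_sq_real (Q - Q') a'
    have q2 := norm_add_sq_real (Q - Q') a'
    rw [na'] at q1 q2
    rw [abs_le]
    constructor <;> nlinarith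
  have : inner ℝ (Q - Q') a0 = inner ℝ (Q - Q') a' + inner ℝ (Q - Q') (a0 - a') := by
    rw [← inner_add_right]; congr 1; abel
  rw [this]
  refine (abs_add_le _ _).trans (add_le_add hB ?_)
  exact (abs_real_inner_le_norm _ _).trans (mul_le_mul_of_nonneg_left hA (norm_nonneg _))

lemma vol_local {d : ℕ} (hd : 2 ≤ d)
    (D : Set (EuclideanSpace ℝ (Fin d))) (hDopen : IsOpen D) (hDu : D ≠ univ)
    (r₀ : ℝ) (hr₀ : 0 < r₀)
    (hC11 : ∀ Q ∈ frontier D, ∃ x' x'' : EuclideanSpace ℝ (Fin d),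
      Metric.ball x' r₀ ⊆ D ∧ Metric.ball x'' r₀ ⊆ Dᶜ ∧
      dist x' Q = r₀ ∧ dist x'' Q = r₀)
    (y : EuclideanSpace ℝ (Fin d)) (s t : ℝ) (ht : 0 < t) (hts : t ≤ s) (hs : s ≤ r₀ / 16) :
    volume {w | w ∈ D ∧ deltaD D w < t ∧ dist w y < s} ≤
      ENNReal.ofReal (2 * 8 ^ d * s ^ (d - 1) * t) *
        volume (ball (0 : EuclideanSpace ℝ (Fin d)) 1) := by
  set S := {w | w ∈ D ∧ deltaD D w < t ∧ dist w y < s} with hS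
  rcases S.eq_empty_or_nonempty with h0 | ⟨w0, hw0⟩
  · rw [h0]; simp
  have hs0 : 0 < s := ht.trans_le hts
  have hSm : MeasurableSet S := by
    apply IsOpen.measurableSet
    apply hDopen.inter
    apply IsOpen.inter
    · exact isOpen_lt (continuous_infDist_pt _) continuous_const
    · exact isOpen_lt (continuous_id.dist continuous_const) continuous_const
  have hfr : ∀ w ∈ S, ∃ Q ∈ frontier D, dist w Q < t := by
    rintro w ⟨h1, h2, h3⟩
    obtain ⟨Q, hQ, e⟩ := exists_mem_frontier_infDist_compl_eq_dist h1 hDu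
    exact ⟨Q, hQ, by rw [← e]; exact h2⟩
  have hnv : ∀ Q ∈ frontier D, ∃ a, ‖a‖ = r₀ ∧ ball (Q + a) r₀ ⊆ D ∧ ball (Q - a) r₀ ⊆ Dᶜ := by
    intro Q hQ
    obtain ⟨x', x'', h1, h2, h3, h4⟩ := hC11 Q hQ
    exact normal_vec D r₀ hr₀ Q x' x'' h1 h2 h3 h4
  obtain ⟨Q0, hQ0, hwQ0⟩ := hfr w0 hw0
  obtain ⟨a0, na0, b1, b2⟩ := hnv Q0 hQ0
  have key : ∀ w ∈ S, ∀ w' ∈ S, ∀ m : ℝ, 1 ≤ m → w - w' ≠ (m * (7 * t / r₀)) • a0 := by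
    intro w hw w' hw' m hm heq
    obtain ⟨Q, hQ, hwQ⟩ := hfr w hw
    obtain ⟨Q', hQ', hwQ'⟩ := hfr w' hw'
    obtain ⟨a', na', c1, c2⟩ := hnv Q' hQ'
    have h := two_pts D hDopen r₀ hr₀ Q Q' Q0 a' a0 hQ na' c1 c2 na0 b1 b2
    have g1 : dist w y < s := hw.2.2
    have g2 : dist w' y < s := hw'.2.2
    have g3 : dist w0 y < s := hw0.2.2
    have g4 : ‖Q' - Q0‖ ≤ 4 * s := by
      rw [← dist_eq_norm]
      have := dist_triangle Q' w' Q0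
      have := dist_triangle w' y Q0
      have := dist_triangle y w0 Q0
      rw [dist_comm] at hwQ'
      rw [dist_comm] at g3
      linarith
    have g5 : ‖Q - Q'‖ ≤ 4 * s := by
      rw [← dist_eq_norm]
      have := dist_triangle Q w Q'
      have := dist_triangle w y Q'
      have := dist_triangle y w' Q'
      rw [dist_comm] at hwQ
      rw [dist_comm] at g2
      linarith
    set u := (Q - Q') - (w - w') with hu
    have nu : ‖u‖ ≤ 2 * t := by
      have : u = (Q - w) - (Q' - w') := by rw [hu]; abel
      rw [this]
      refine (norm_sub_le _ _).trans ?_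
      rw [← dist_eq_norm, ← dist_eq_norm, dist_comm Q, dist_comm Q']
      linarith
    have e : Q - Q' = (m * (7 * t / r₀)) • a0 + u := by rw [hu, ← heq]; abel
    have i1 : inner ℝ (Q - Q') a0 = m * (7 * t) * r₀ + inner ℝ u a0 := by
      rw [e, inner_add_left, real_inner_smul_left, real_inner_self_eq_norm_sq, na0]
      field_simp
    have i2 : |inner ℝ u a0| ≤ 2 * t * r₀ := by
      refine (abs_real_inner_le_norm _ _).trans ?_
      rw [na0]; gcongr
    have i3 : ‖Q - Q'‖ ≤ m * (7 * t) + 2 * t := by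
      rw [e]
      refine (norm_add_le _ _).trans (add_le_add ?_ nu)
      rw [norm_smul, na0, Real.norm_of_nonneg (by positivity)]
      apply le_of_eq; field_simp
    have i4 := (abs_le.1 i2).1
    have i5 := (abs_le.1 h).2
    have i6 : ‖Q - Q'‖ ^ 2 / 2 + ‖Q - Q'‖ * ‖Q' - Q0‖ ≤ ‖Q - Q'‖ * (r₀ / 2) := by
      nlinarith [norm_nonneg (Q - Q')]
    have i7 : ‖Q - Q'‖ * (r₀ / 2) ≤ (m * (7 * t) + 2 * t) * (r₀ / 2) := by gcongr
    have i8 : t * r₀ ≤ m * (t * r₀) := le_mul_of_one_le_left (by positivity) hm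
    nlinarith [mul_pos ht hr₀]
  set v := (7 * t / r₀) • a0 with hv
  have nv : ‖v‖ = 7 * t := by
    rw [hv, norm_smul, na0, Real.norm_of_nonneg (by positivity)]; field_simp
  set N := ⌊s / t⌋₊ with hN
  have hst : 1 ≤ s / t := (one_le_div ht).2 hts
  have hN1 : (N : ℝ) * t ≤ s := by
    have := Nat.floor_le (a := s / t) (by positivity)
    rwa [le_div_iff₀ ht] at this
  have hN2 : s ≤ 2 * N * t := by
    have a1 : 1 ≤ N := Nat.le_floor (by simpa using hst)
    have a2 := Nat.lt_floor_add_one (s / t)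
    rw [div_lt_iff₀ ht] at a2
    have a3 : (1 : ℝ) ≤ N := by exact_mod_cast a1
    rw [← hN] at a2
    nlinarith
  let T : ℕ → Set (EuclideanSpace ℝ (Fin d)) := fun m => (fun w => w + (m : ℝ) • v) ⁻¹' S
  have hTm : ∀ m, MeasurableSet (T m) := fun m => (measurable_add_const _) hSm
  have hTv : ∀ m, volume (T m) = volume S := fun m => measure_preimage_add_right _ _ _
  have aux : ∀ m n : ℕ, m < n → Disjoint (T m) (T n) := by
    intro m n hmn
    rw [Set.disjoint_left]
    intro x hx hx'
    refine key _ hx' _ hx ((n : ℝ) - m) ?_ ?_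
    · have : (m : ℝ) + 1 ≤ n := by exact_mod_cast hmn
      linarith
    · rw [mul_smul, ← hv, sub_smul]
      change (x + (n : ℝ) • v) - (x + (m : ℝ) • v) = _
      abel
  have hdisj : Pairwise (Function.onFun Disjoint T) := by
    intro m n hmn
    rcases lt_or_gt_of_ne hmn with h | h
    · exact aux _ _ h
    · exact (aux _ _ h).symm
  have hsub : (⋃ m ∈ Finset.range N, T m) ⊆ ball y (8 * s) := by
    intro x hx
    simp only [mem_iUnion, Finset.mem_range] at hx
    obtain ⟨m, hm, hx⟩ := hx
    have h3 : dist (x + (m : ℝ) • v) y < s := hx.2.2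
    have h4 : dist x (x + (m : ℝ) • v) = m * (7 * t) := by
      rw [dist_self_add_right, norm_smul, nv]; simp
    have h5 : (m : ℝ) * t ≤ N * t := by gcongr
    have := dist_triangle x (x + (m : ℝ) • v) y
    rw [mem_ball]; linarith
  have hsum : (N : ENNReal) * volume S ≤ volume (ball y (8 * s)) := by
    have := measure_mono (μ := volume) hsub
    rw [measure_biUnion_finset (fun i _ j _ hij => hdisj hij) (fun m _ => hTm m)] at this
    simpa [hTv] using this
  rw [Measure.addHaar_ball_of_pos _ _ (by positivity)] at hsum
  rw [finrank_euclideanSpace_fin] at hsum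
  have hNpos : 0 < N := Nat.pos_of_ne_zero (by rintro h; rw [h] at hN2; simp at hN2; linarith)
  have hNR : (0:ℝ) < N := by exact_mod_cast hNpos
  have hNE : (N : ENNReal) = ENNReal.ofReal N := by simp
  have h9 : volume S ≤ ENNReal.ofReal ((8 * s) ^ d / N) *
      volume (ball (0 : EuclideanSpace ℝ (Fin d)) 1) := by
    rw [ENNReal.ofReal_div_of_pos hNR, ← hNE]
    rw [mul_comm] at hsum
    have h10 := (ENNReal.le_div_iff_mul_le (Or.inl (by simpa using hNpos.ne'))
      (Or.inl (by simp))).2 hsum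
    rw [div_eq_mul_inv] at h10 ⊢
    rwa [mul_right_comm] at h10
  refine h9.trans ?_
  gcongr
  rw [div_le_iff₀ hNR, mul_pow]
  have : s ^ d = s ^ (d - 1) * s := by rw [← pow_succ]; congr 1; omega
  rw [this]
  have : 0 < (8:ℝ) ^ d * s ^ (d-1) := by positivity
  nlinarith


lemma vol_global {d : ℕ} (hd : 2 ≤ d)
    (D : Set (EuclideanSpace ℝ (Fin d))) (hDopen : IsOpen D) (hDu : D ≠ univ)
    (hDbdd : Bornology.IsBounded D)
    (r₀ : ℝ) (hr₀ : 0 < r₀)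
    (hC11 : ∀ Q ∈ frontier D, ∃ x' x'' : EuclideanSpace ℝ (Fin d),
      Metric.ball x' r₀ ⊆ D ∧ Metric.ball x'' r₀ ⊆ Dᶜ ∧
      dist x' Q = r₀ ∧ dist x'' Q = r₀) (L : ℝ) (hL : 0 < L) :
    ∃ C : ℝ, 0 < C ∧ ∀ (y : EuclideanSpace ℝ (Fin d)) (s t : ℝ), 0 < t → t ≤ s → s ≤ L →
      volume {w | w ∈ D ∧ deltaD D w < t ∧ dist w y < s} ≤
        ENNReal.ofReal (C * s ^ (d - 1) * t) := by
  set W := (volume (ball (0 : EuclideanSpace ℝ (Fin d)) 1)).toReal with hW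
  have hWE : volume (ball (0 : EuclideanSpace ℝ (Fin d)) 1) = ENNReal.ofReal W := by
    rw [hW, ENNReal.ofReal_toReal measure_ball_lt_top.ne]
  have hW0 : 0 < W := ENNReal.toReal_pos (measure_ball_pos _ _ one_pos).ne' measure_ball_lt_top.ne
  obtain ⟨F0, -, hF, hcov⟩ := finite_cover_balls_of_compact
    (hDbdd.isCompact_closure) (e := r₀ / 16) (by positivity)
  obtain ⟨F, rfl⟩ := hF.exists_finset_coe
  set C0 : ℝ := 2 * 8 ^ d * W with hC0
  have hC0p : 0 < C0 := by positivity
  have hloc : ∀ (y : EuclideanSpace ℝ (Fin d)) (s t : ℝ), 0 < t → t ≤ s → s ≤ r₀ / 16 →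
      volume {w | w ∈ D ∧ deltaD D w < t ∧ dist w y < s} ≤
        ENNReal.ofReal (C0 * s ^ (d - 1) * t) := by
    intro y s t ht hts hs
    have hs0 := ht.trans_le hts
    refine (vol_local hd D hDopen hDu r₀ hr₀ hC11 y s t ht hts hs).trans ?_
    rw [hWE, ← ENNReal.ofReal_mul (by positivity)]
    apply ENNReal.ofReal_le_ofReal
    apply le_of_eq; rw [hC0]; ring
  obtain ⟨n, hn⟩ : ∃ n : ℝ, n = F.card := ⟨_, rfl⟩
  have hn0 : 0 ≤ n := by rw [hn]; exact Nat.cast_nonneg _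
  refine ⟨C0 + n * C0 + W * L * (16 / r₀), by positivity, ?_⟩
  intro y s t ht hts hs
  have hs0 := ht.trans_le hts
  have k1 : 0 ≤ C0 * s ^ (d-1) * t := by positivity
  have k2 : 0 ≤ n * C0 * s ^ (d-1) * t := by positivity
  have k3 : 0 ≤ W * L * (16 / r₀) * s ^ (d-1) * t := by positivity
  by_cases h1 : s ≤ r₀ / 16
  · refine (hloc y s t ht hts h1).trans (ENNReal.ofReal_le_ofReal ?_)
    linarith
  push Not at h1
  by_cases h2 : t ≤ r₀ / 16
  · have hsub : {w | w ∈ D ∧ deltaD D w < t ∧ dist w y < s} ⊆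
        ⋃ x ∈ F, {w | w ∈ D ∧ deltaD D w < t ∧ dist w x < r₀ / 16} := by
      rintro w ⟨a1, a2, a3⟩
      have := hcov (subset_closure a1)
      simp only [mem_iUnion, Finset.mem_coe, mem_ball] at this
      obtain ⟨x, hx, h⟩ := this
      simp only [mem_iUnion]
      exact ⟨x, hx, a1, a2, h⟩
    refine (measure_mono hsub).trans ((measure_biUnion_finset_le _ _).trans ?_)
    refine (Finset.sum_le_sum (fun x _ => hloc x (r₀ / 16) t ht h2 le_rfl)).trans ?_
    rw [Finset.sum_const, nsmul_eq_mul, ← ENNReal.ofReal_natCast, ← hn,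
      ← ENNReal.ofReal_mul hn0]
    apply ENNReal.ofReal_le_ofReal
    have : n * (C0 * (r₀ / 16) ^ (d-1) * t) ≤ n * (C0 * s ^ (d-1) * t) := by
      gcongr
    linarith
  · push Not at h2
    have hsub : {w | w ∈ D ∧ deltaD D w < t ∧ dist w y < s} ⊆ ball y s := fun w hw => hw.2.2
    refine (measure_mono hsub).trans ?_
    rw [Measure.addHaar_ball_of_pos _ _ hs0, finrank_euclideanSpace_fin, hWE,
      ← ENNReal.ofReal_mul (by positivity)]
    apply ENNReal.ofReal_le_ofReal
    have e : s ^ d = s ^ (d - 1) * s := by rw [← pow_succ]; congr 1; omega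
    have e2 : 1 ≤ 16 / r₀ * t := by
      rw [div_mul_eq_mul_div, one_le_div hr₀]; linarith
    have : s ^ d * W ≤ W * L * (16 / r₀) * s ^ (d-1) * t := by
      rw [e]
      calc s ^ (d-1) * s * W ≤ s ^ (d-1) * L * W * 1 := by rw [mul_one]; gcongr
        _ ≤ s ^ (d-1) * L * W * (16 / r₀ * t) := by gcongr
        _ = _ := by ring
    linarith

lemma strip1 {d : ℕ} (D : Set (EuclideanSpace ℝ (Fin d))) (hDopen : IsOpen D)
    (β : EuclideanSpace ℝ (Fin d) → ENNReal) (hβ : Measurable β)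
    (s t : ℝ) (ht : 0 < t) (hts : t ≤ s) (M : ENNReal)
    (hM : ∀ w, ∫⁻ z in ball w (t / 4), β z ≤ M) (y : EuclideanSpace ℝ (Fin d)) :
    volume (ball (0 : EuclideanSpace ℝ (Fin d)) (t / 4)) *
      ∫⁻ z in {z | z ∈ D ∧ t / 2 < deltaD D z ∧ deltaD D z ≤ t ∧ dist y z ≤ s}, β z ≤
    M * volume {w | w ∈ D ∧ deltaD D w < 2 * t ∧ dist w y < 2 * s} := by
  set E := {z | z ∈ D ∧ t / 2 < deltaD D z ∧ deltaD D z ≤ t ∧ dist y z ≤ s} with hE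
  set N := {w | w ∈ D ∧ deltaD D w < 2 * t ∧ dist w y < 2 * s} with hN
  have hEm : MeasurableSet E := by
    have c : Continuous (deltaD D) := continuous_infDist_pt _
    refine hDopen.measurableSet.inter (MeasurableSet.inter ?_ (MeasurableSet.inter ?_ ?_))
    · exact (isOpen_lt continuous_const c).measurableSet
    · exact (isClosed_le c continuous_const).measurableSet
    · exact (isClosed_le (continuous_const.dist continuous_id) continuous_const).measurableSet
  let P : Set (EuclideanSpace ℝ (Fin d) × EuclideanSpace ℝ (Fin d)) := {p | dist p.1 p.2 < t / 4}
  have hP : MeasurableSet P :=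
    (isOpen_lt (continuous_fst.dist continuous_snd) continuous_const).measurableSet
  let f : EuclideanSpace ℝ (Fin d) → EuclideanSpace ℝ (Fin d) → ENNReal :=
    fun z w => P.indicator (fun p => β p.1) (z, w)
  have hf : Measurable (Function.uncurry f) := (hβ.comp measurable_fst).indicator hP
  have e1 : volume (ball (0 : EuclideanSpace ℝ (Fin d)) (t / 4)) * ∫⁻ z in E, β z =
      ∫⁻ z in E, ∫⁻ w, f z w := by
    rw [← lintegral_const_mul _ hβ]
    congr 1; ext z
    have : f z = (ball z (t / 4)).indicator (fun _ => β z) := by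
      ext w
      simp only [f, P, indicator, mem_ofPred_eq, mem_ball]
      rw [dist_comm]
    rw [this, lintegral_indicator_const measurableSet_ball, mul_comm]
    congr 1
    rw [Measure.addHaar_ball_center volume z]
  rw [e1, lintegral_lintegral_swap hf.aemeasurable]
  refine le_trans (lintegral_mono (g := N.indicator (fun _ => M)) ?_) (lintegral_indicator_const_le _ _)
  intro w
  by_cases hw : w ∈ N
  · simp only [hw, indicator_of_mem]
    refine le_trans (setLIntegral_le_lintegral _ _) (le_trans (le_of_eq ?_) (hM w))
    rw [← lintegral_indicator measurableSet_ball]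
    congr 1
  · simp only [hw, indicator_of_notMem, not_false_eq_true]
    rw [nonpos_iff_eq_zero]
    have hfw : Measurable (fun z => f z w) := hf.of_uncurry_right
    rw [setLIntegral_eq_zero_iff hEm hfw]
    refine ae_of_all _ ?_
    rintro z ⟨a1, a2, a3, a4⟩
    apply indicator_of_notMem
    intro h
    have h : dist z w < t / 4 := h
    apply hw
    have b1 : deltaD D z ≤ deltaD D w + dist z w := infDist_le_infDist_add_dist
    have b2 : deltaD D w ≤ deltaD D z + dist w z := infDist_le_infDist_add_dist
    have b3 := dist_triangle w z y
    rw [dist_comm w z] at b2 b3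
    rw [dist_comm z y] at b3
    refine ⟨?_, by linarith, by linarith⟩
    by_contra hc
    have : deltaD D w = 0 := infDist_zero_of_mem hc
    linarith

lemma strip2 {d : ℕ} (hd : 2 ≤ d)
    (D : Set (EuclideanSpace ℝ (Fin d))) (hDopen : IsOpen D)
    (L C : ℝ) (hC0 : 0 < C) (hC : ∀ (y : EuclideanSpace ℝ (Fin d)) (s t : ℝ), 0 < t → t ≤ s → s ≤ 2 * L →
      volume {w | w ∈ D ∧ deltaD D w < t ∧ dist w y < s} ≤
        ENNReal.ofReal (C * s ^ (d - 1) * t))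
    (V : ℝ → ℝ)
    (hVpos : ∀ r : ℝ, 0 < r → 0 < V r)
    (hVdec : ∀ r s : ℝ, 0 < r → r ≤ s → (V s) ^ 2 / s ^ (d + 1) ≤ (V r) ^ 2 / r ^ (d + 1))
    (b : EuclideanSpace ℝ (Fin d) → EuclideanSpace ℝ (Fin d)) (hb : Measurable b) :
    ∃ C' : ℝ, 0 < C' ∧ ∀ (s t ρ : ℝ) (ε : ENNReal) (y : EuclideanSpace ℝ (Fin d)),
      0 < t → t ≤ s → s ≤ L → t ≤ 4 * ρ →
      (∀ x : EuclideanSpace ℝ (Fin d), ∫⁻ z in Metric.ball x ρ,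
          ENNReal.ofReal ((V (dist x z)) ^ 2 / (dist x z) ^ (d + 1) * ‖b z‖) ≤ ε) →
      ∫⁻ z in {z | z ∈ D ∧ t / 2 < deltaD D z ∧ deltaD D z ≤ t ∧ dist y z ≤ s},
        ENNReal.ofReal ‖b z‖ ≤ ENNReal.ofReal (C' * s ^ (d - 1) * t ^ 2 / (V t) ^ 2) * ε := by
  set W := (volume (ball (0 : EuclideanSpace ℝ (Fin d)) 1)).toReal with hW
  have hWE : volume (ball (0 : EuclideanSpace ℝ (Fin d)) 1) = ENNReal.ofReal W := by
    rw [hW, ENNReal.ofReal_toReal measure_ball_lt_top.ne]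
  have hW0 : 0 < W := ENNReal.toReal_pos (measure_ball_pos _ _ one_pos).ne' measure_ball_lt_top.ne
  refine ⟨C * 2 ^ (d-1) * 2 * 4 ^ d / W, by positivity, ?_⟩
  intro s t ρ ε y ht hts hs htρ hK
  have hs0 := ht.trans_le hts
  have hVt := hVpos t ht
  have : Nonempty (Fin d) := ⟨⟨0, by omega⟩⟩
  have hbm : Measurable (fun z => ENNReal.ofReal ‖b z‖) := hb.norm.ennreal_ofReal
  have hM : ∀ w, ∫⁻ z in ball w (t / 4), ENNReal.ofReal ‖b z‖ ≤
      ENNReal.ofReal (t ^ (d+1) / (V t) ^ 2) * ε := by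
    intro w
    calc ∫⁻ z in ball w (t / 4), ENNReal.ofReal ‖b z‖
        ≤ ∫⁻ z in ball w (t / 4), ENNReal.ofReal (t ^ (d+1) / (V t) ^ 2) *
          ENNReal.ofReal ((V (dist w z)) ^ 2 / (dist w z) ^ (d + 1) * ‖b z‖) := by
          apply lintegral_mono_ae
          have h1 : ∀ᵐ z ∂(volume.restrict (ball w (t/4))), z ≠ w := by
            apply ae_restrict_of_ae
            exact Measure.ae_ne volume w
          filter_upwards [h1, ae_restrict_mem measurableSet_ball] with z hz hzb
          rw [← ENNReal.ofReal_mul (by positivity)]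
          apply ENNReal.ofReal_le_ofReal
          have hp : 0 < dist w z := dist_pos.2 hz.symm
          rw [mem_ball, dist_comm] at hzb
          have h2 := hVdec (dist w z) t hp (by linarith)
          calc ‖b z‖ = t ^ (d+1) / (V t) ^ 2 * ((V t) ^ 2 / t ^ (d + 1) * ‖b z‖) := by
                field_simp
            _ ≤ _ := by gcongr
      _ = ENNReal.ofReal (t ^ (d+1) / (V t) ^ 2) * ∫⁻ z in ball w (t / 4),
          ENNReal.ofReal ((V (dist w z)) ^ 2 / (dist w z) ^ (d + 1) * ‖b z‖) :=
          lintegral_const_mul' _ _ ENNReal.ofReal_ne_top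
      _ ≤ _ := by
          gcongr
          refine le_trans (lintegral_mono_set (ball_subset_ball (by linarith))) (hK w)
  have h1 := strip1 D hDopen _ hbm s t ht hts _ hM y
  have h2 := hC y (2 * s) (2 * t) (by linarith) (by linarith) (by linarith)
  have h3 := h1.trans (mul_le_mul_right h2 _)
  rw [Measure.addHaar_ball_of_pos _ _ (by positivity), finrank_euclideanSpace_fin, hWE,
      ← ENNReal.ofReal_mul (by positivity)] at h3
  have hk : 0 < (t/4)^d * W := by positivity
  set I := ∫⁻ z in {z | z ∈ D ∧ t / 2 < deltaD D z ∧ deltaD D z ≤ t ∧ dist y z ≤ s},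
        ENNReal.ofReal ‖b z‖
  calc I = ENNReal.ofReal (((t/4)^d * W)⁻¹) * (ENNReal.ofReal ((t/4)^d * W) * I) := by
        rw [← mul_assoc, ← ENNReal.ofReal_mul (by positivity), inv_mul_cancel₀ hk.ne']; simp
    _ ≤ ENNReal.ofReal (((t/4)^d * W)⁻¹) * (ENNReal.ofReal (t ^ (d+1) / (V t) ^ 2) * ε *
          ENNReal.ofReal (C * (2 * s) ^ (d - 1) * (2 * t))) := by gcongr
    _ = ENNReal.ofReal (((t/4)^d * W)⁻¹ * (t ^ (d+1) / (V t) ^ 2) *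
         (C * (2 * s) ^ (d - 1) * (2 * t))) * ε := by
        rw [ENNReal.ofReal_mul (p := ((t/4)^d * W)⁻¹ * (t ^ (d+1) / (V t) ^ 2)) (by positivity),
          ENNReal.ofReal_mul (p := ((t/4)^d * W)⁻¹) (by positivity)]
        generalize ENNReal.ofReal (((t/4)^d * W)⁻¹) = A
        generalize ENNReal.ofReal (t ^ (d+1) / (V t) ^ 2) = B
        generalize ENNReal.ofReal (C * (2 * s) ^ (d - 1) * (2 * t)) = G
        ring
    _ = _ := by
        congr 2
        rw [mul_pow, div_pow]
        field_simp
        ring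


section realV

variable {d : ℕ} {V : ℝ → ℝ}

lemma V_lin (hVsub : ∀ lam r : ℝ, 1 ≤ lam → 0 ≤ r → V (lam * r) ≤ lam * V r)
    {r s : ℝ} (hr : 0 < r) (hrs : r ≤ s) : V s * r ≤ s * V r := by
  have h := hVsub (s / r) r ((one_le_div hr).2 hrs) hr.le
  rw [div_mul_cancel₀ _ hr.ne'] at h
  rw [← le_div_iff₀ hr]
  refine h.trans (le_of_eq ?_)
  ring

lemma V_dec (hd : 2 ≤ d) (hVpos : ∀ r : ℝ, 0 < r → 0 < V r)
    (hVsub : ∀ lam r : ℝ, 1 ≤ lam → 0 ≤ r → V (lam * r) ≤ lam * V r)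
    (r s : ℝ) (hr : 0 < r) (hrs : r ≤ s) :
    (V s) ^ 2 / s ^ (d + 1) ≤ (V r) ^ 2 / r ^ (d + 1) := by
  have hs := hr.trans_le hrs
  have h := V_lin hVsub hr hrs
  have h1 := hVpos s hs
  have h2 := hVpos r hr
  rw [div_le_div_iff₀ (by positivity) (by positivity)]
  have e : ∀ x : ℝ, x ^ (d + 1) = x ^ 2 * x ^ (d - 1) := fun x => by
    rw [← pow_add]; congr 1; omega
  rw [e, e]
  calc V s ^ 2 * (r ^ 2 * r ^ (d-1)) = (V s * r) ^ 2 * r ^ (d-1) := by ring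
    _ ≤ (s * V r) ^ 2 * s ^ (d-1) := by gcongr
    _ = _ := by ring

lemma H_near (hVpos : ∀ r : ℝ, 0 < r → 0 < V r)
    (hVmono : ∀ r s : ℝ, 0 ≤ r → r ≤ s → V r ≤ V s)
    (a c s : ℝ) (ha : 0 < a) (hc : 0 < c) (hs : 0 < s) (hsc : s ≤ c) :
    (V s) ^ 2 / s ^ d * (V a * V c / (V (max (max a c) s)) ^ 2) * (max c s / (s * c)) ≤
      (V s) ^ 2 / s ^ (d + 1) := by
  set r := max (max a c) s with hr
  have ar : a ≤ r := (le_max_left _ _).trans (le_max_left _ _)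
  have cr : c ≤ r := (le_max_right _ _).trans (le_max_left _ _)
  have hr0 := ha.trans_le ar
  have v1 := hVpos a ha
  have v2 := hVpos c hc
  have v3 := hVpos s hs
  have v4 := hVpos r hr0
  rw [max_eq_left hsc]
  have h1 : V a * V c / V r ^ 2 ≤ 1 := by
    rw [div_le_one (by positivity), sq]
    exact mul_le_mul (hVmono _ _ ha.le ar) (hVmono _ _ hc.le cr) v2.le v4.le
  calc _ ≤ (V s) ^ 2 / s ^ d * 1 * (c / (s * c)) := by gcongr
    _ = _ := by rw [pow_succ]; field_simp; try ring

lemma H_far (hVpos : ∀ r : ℝ, 0 < r → 0 < V r)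
    (hVmono : ∀ r s : ℝ, 0 ≤ r → r ≤ s → V r ≤ V s)
    (a c s : ℝ) (ha : 0 < a) (hc : 0 < c) (hs : 0 < s) (hsc : c < s) :
    (V s) ^ 2 / s ^ d * (V a * V c / (V (max (max a c) s)) ^ 2) * (max c s / (s * c)) ≤
      V a * V c / (s ^ d * c) := by
  set r := max (max a c) s with hr
  have sr : s ≤ r := (le_max_right _ _)
  have hr0 := hs.trans_le sr
  have v1 := hVpos a ha
  have v2 := hVpos c hc
  have v3 := hVpos s hs
  have v4 := hVpos r hr0
  rw [max_eq_right hsc.le]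
  have h1 : V s ^ 2 / V r ^ 2 ≤ 1 := by
    rw [div_le_one (by positivity)]
    have := hVmono _ _ hs.le sr
    gcongr
  calc _ = (V s ^ 2 / V r ^ 2) * (V a * V c / (s ^ d * c)) := by field_simp
    _ ≤ 1 * (V a * V c / (s ^ d * c)) := by gcongr
    _ = _ := one_mul _

lemma H_far2 (hd : 2 ≤ d) (hVpos : ∀ r : ℝ, 0 < r → 0 < V r)
    (hVsub : ∀ lam r : ℝ, 1 ≤ lam → 0 ≤ r → V (lam * r) ≤ lam * V r)
    (hVmono : ∀ r s : ℝ, 0 ≤ r → r ≤ s → V r ≤ V s)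
    (a c s : ℝ) (ha : 0 < a) (hc : 0 < c) (hs : 0 < s) (hsc : c < s) :
    (V s) ^ 2 / s ^ d * (V a * V c / (V (max (max a c) s)) ^ 2) * (max c s / (s * c)) ≤
      V c ^ 2 / c ^ (d + 1) := by
  set r := max (max a c) s with hr
  have sr : s ≤ r := (le_max_right _ _)
  have ar : a ≤ r := (le_max_left _ _).trans (le_max_left _ _)
  have hr0 := hs.trans_le sr
  have v1 := hVpos a ha
  have v2 := hVpos c hc
  have v3 := hVpos s hs
  have v4 := hVpos r hr0
  rw [max_eq_right hsc.le]
  have h1 : V s * V a / V r ^ 2 ≤ 1 := by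
    rw [div_le_one (by positivity), sq]
    exact mul_le_mul (hVmono _ _ hs.le sr) (hVmono _ _ ha.le ar) v1.le v4.le
  have h2 : V s / s ^ d ≤ V c / c ^ d := by
    rw [div_le_div_iff₀ (by positivity) (by positivity)]
    have e : ∀ x : ℝ, x ^ d = x * x ^ (d - 1) := fun x => by
      rw [← pow_succ']; congr 1; omega
    rw [e, e]
    calc V s * (c * c ^ (d-1)) = (V s * c) * c ^ (d-1) := by ring
      _ ≤ (s * V c) * s ^ (d-1) := by
        have := V_lin hVsub hc hsc.le
        gcongr
      _ = _ := by ring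
  calc _ = (V s * V a / V r ^ 2) * (V s / s ^ d * (V c / c)) := by field_simp
    _ ≤ 1 * (V c / c ^ d * (V c / c)) := by gcongr
    _ = _ := by rw [pow_succ]; field_simp; try ring

lemma V_cell (hVpos : ∀ r : ℝ, 0 < r → 0 < V r)
    (hVsub : ∀ lam r : ℝ, 1 ≤ lam → 0 ≤ r → V (lam * r) ≤ lam * V r)
    (hVmono : ∀ r s : ℝ, 0 ≤ r → r ≤ s → V r ≤ V s) (L : ℝ)
    (c₂ α₁ : ℝ) (hc₂ : 1 ≤ c₂) (hα₁ : 1 < α₁)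
    (hVlow : ∀ η r : ℝ, 0 < η → η ≤ 1 → 0 < r → r ≤ L →
      V (η * r) ≤ c₂ * η ^ (α₁ / 2) * V r)
    (Cbar abar : ℝ) (hCbar : 1 ≤ Cbar)
    (hVup : ∀ lam r : ℝ, 1 ≤ lam → 0 < r →
      V (lam * r) ≤ Cbar * lam ^ (abar / 2) * V r)
    (a s t : ℝ) (i : ℕ) (ha : 0 < a) (hs : 0 < s) (hsL : s ≤ L) (has : a < 2 * s)
    (hst : t = s * (1 / 2) ^ i) :
    V a * t / (s * V t) ≤
      2 * c₂ * Cbar * (a / s) ^ (α₁ / 2) * ((2 : ℝ) ^ (abar / 2 - 1)) ^ i := by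
  have ht : 0 < t := by rw [hst]; positivity
  have v1 := hVpos a ha
  have v2 := hVpos t ht
  have v3 := hVpos s hs
  have h1 : V a ≤ 2 * c₂ * (a / s) ^ (α₁ / 2) * V s := by
    by_cases h : a ≤ s
    · have := hVlow (a / s) s (by positivity) ((div_le_one hs).2 h) hs hsL
      rw [div_mul_cancel₀ _ hs.ne'] at this
      have p : 0 ≤ c₂ * (a / s) ^ (α₁ / 2) * V s := by positivity
      linarith
    · push Not at h
      have h2 := hVmono a (2 * s) ha.le has.le
      have h3 := hVsub 2 s (by norm_num) hs.le
      have h4 : 1 ≤ (a / s) ^ (α₁ / 2) :=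
        Real.one_le_rpow ((one_le_div hs).2 h.le) (by linarith)
      have h5 : 1 ≤ c₂ * (a / s) ^ (α₁ / 2) := one_le_mul_of_one_le_of_one_le hc₂ h4
      nlinarith
  have h2 : V s ≤ Cbar * ((2 : ℝ) ^ (abar / 2)) ^ i * V t := by
    have := hVup (2 ^ i) t (one_le_pow₀ (by norm_num)) ht
    have e : (2:ℝ) ^ i * t = s := by
      rw [hst, mul_comm s, ← mul_assoc, ← mul_pow]; norm_num
    rw [e] at this
    have e2 : ((2:ℝ) ^ i) ^ (abar / 2) = ((2 : ℝ) ^ (abar / 2)) ^ i := by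
      rw [← Real.rpow_natCast, ← Real.rpow_mul (by norm_num), ← Real.rpow_natCast,
        ← Real.rpow_mul (by norm_num), mul_comm]
    rwa [e2] at this
  have e3 : ((2 : ℝ) ^ (abar / 2 - 1)) ^ i = ((2 : ℝ) ^ (abar / 2)) ^ i * (1 / 2) ^ i := by
    rw [Real.rpow_sub_one (by norm_num), div_eq_mul_one_div, mul_pow]
  have e4 : t / s = (1 / 2) ^ i := by rw [hst]; field_simp
  rw [e3]
  calc V a * t / (s * V t) = V a * (t / s) / V t := by field_simp
    _ = V a * (1 / 2) ^ i / V t := by rw [e4]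
    _ ≤ (2 * c₂ * (a / s) ^ (α₁ / 2) * (Cbar * ((2 : ℝ) ^ (abar / 2)) ^ i * V t))
          * (1 / 2) ^ i / V t := by
        have : V a ≤ 2 * c₂ * (a / s) ^ (α₁ / 2) * (Cbar * ((2 : ℝ) ^ (abar / 2)) ^ i * V t) :=
          h1.trans (by gcongr)
        gcongr
    _ = _ := by field_simp

end realV

lemma sum_k (a L β : ℝ) (ha : 0 < a) (hL : 0 < L) (hβ : 0 < β) :
    ∑' k : ℕ, (if a < 2 * (L * (1 / 2) ^ k) then
        ENNReal.ofReal ((a / (L * (1 / 2) ^ k)) ^ β) else 0) ≤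
      ENNReal.ofReal (2 ^ β) * (1 - ENNReal.ofReal ((1 / 2) ^ β))⁻¹ := by
  by_cases h : 2 * L ≤ a
  · have : ∀ k : ℕ, (if a < 2 * (L * (1 / 2) ^ k) then
        ENNReal.ofReal ((a / (L * (1 / 2) ^ k)) ^ β) else 0) = 0 := by
      intro k
      rw [if_neg]
      push Not
      have : ((1:ℝ) / 2) ^ k ≤ 1 := pow_le_one₀ (by norm_num) (by norm_num)
      nlinarith
    simp only [this, tsum_zero]
    exact zero_le
  push Not at h
  obtain ⟨N, hN1, hN2⟩ := exists_nat_pow_near_of_lt_one (x := a / (2 * L)) (y := 1 / 2)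
    (by positivity) ((div_le_one (by positivity)).2 h.le) (by norm_num) (by norm_num)
  rw [lt_div_iff₀ (by positivity)] at hN1
  rw [div_le_iff₀ (by positivity)] at hN2
  rw [tsum_eq_sum (s := Finset.range (N + 1))]
  · have hb : ∀ k ∈ Finset.range (N + 1), (if a < 2 * (L * (1 / 2) ^ k) then
        ENNReal.ofReal ((a / (L * (1 / 2) ^ k)) ^ β) else 0) ≤
        ENNReal.ofReal (2 ^ β) * (ENNReal.ofReal ((1 / 2) ^ β)) ^ (N + 1 - 1 - k) := by
      intro k hk
      rw [Finset.mem_range] at hk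
      split_ifs
      · rw [← ENNReal.ofReal_pow (by positivity), ← ENNReal.ofReal_mul (by positivity)]
        apply ENNReal.ofReal_le_ofReal
        have e : (((1:ℝ) / 2) ^ β) ^ (N + 1 - 1 - k) = (((1:ℝ) / 2) ^ (N + 1 - 1 - k)) ^ β := by
          rw [← Real.rpow_natCast, ← Real.rpow_mul (by norm_num), ← Real.rpow_natCast,
            ← Real.rpow_mul (by norm_num), mul_comm]
        rw [e, ← Real.mul_rpow (by norm_num) (by positivity)]
        apply Real.rpow_le_rpow (by positivity) _ hβ.le
        rw [div_le_iff₀ (by positivity)]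
        refine hN2.trans (le_of_eq ?_)
        have : ((1:ℝ)/2) ^ N = (1 / 2) ^ (N + 1 - 1 - k) * (1/2) ^ k := by
          rw [← pow_add]; congr 1; omega
        rw [this]; ring
      · exact zero_le
    refine (Finset.sum_le_sum hb).trans ?_
    rw [← Finset.mul_sum, Finset.sum_range_reflect (fun k => ENNReal.ofReal ((1 / 2) ^ β) ^ k)]
    gcongr
    rw [← ENNReal.tsum_geometric]
    exact ENNReal.sum_le_tsum _
  · intro k hk
    rw [Finset.mem_range, not_lt] at hk
    rw [if_neg]
    push Not
    have : ((1:ℝ) / 2) ^ k ≤ (1 / 2) ^ (N + 1) :=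
      pow_le_pow_of_le_one (by norm_num) (by norm_num) hk
    nlinarith


/-- Lemma 3.4: `G_D(y,z)/(δ_D(z) ∧ |y−z|)` (here represented by the comparable
explicit kernel `H`) is uniformly in `y` integrable against `|b(z)| dz` for a
Kato-class drift `b` on a bounded `C^{1,1}` open set. -/
theorem uniform_integrability_H {d : ℕ} (hd : 2 ≤ d)
    (D : Set (EuclideanSpace ℝ (Fin d))) (hDne : D.Nonempty) (hDopen : IsOpen D)
    (hDbdd : Bornology.IsBounded D)
    (r₀ : ℝ) (hr₀ : 0 < r₀)
    (hC11 : ∀ Q ∈ frontier D, ∃ x' x'' : EuclideanSpace ℝ (Fin d),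
      Metric.ball x' r₀ ⊆ D ∧ Metric.ball x'' r₀ ⊆ Dᶜ ∧
      dist x' Q = r₀ ∧ dist x'' Q = r₀)
    (V : ℝ → ℝ)
    (hVmono : ∀ r s : ℝ, 0 ≤ r → r ≤ s → V r ≤ V s)
    (hV0 : V 0 = 0)
    (hVpos : ∀ r : ℝ, 0 < r → 0 < V r)
    (hVsub : ∀ lam r : ℝ, 1 ≤ lam → 0 ≤ r → V (lam * r) ≤ lam * V r)
    (c₂ α₁ : ℝ) (hc₂ : 1 ≤ c₂) (hα₁ : 1 < α₁) (hα₁' : α₁ < 2)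
    (hVlow : ∀ η r : ℝ, 0 < η → η ≤ 1 → 0 < r → r ≤ Metric.diam D →
      V (η * r) ≤ c₂ * η ^ (α₁ / 2) * V r)
    (Cbar abar : ℝ) (hCbar : 1 ≤ Cbar) (habar : 0 < abar) (habar' : abar < 2)
    (hVup : ∀ lam r : ℝ, 1 ≤ lam → 0 < r →
      V (lam * r) ≤ Cbar * lam ^ (abar / 2) * V r)
    (b : EuclideanSpace ℝ (Fin d) → EuclideanSpace ℝ (Fin d)) (hb : Measurable b)
    (hKato : Filter.Tendsto
      (fun r : ℝ => ⨆ x : EuclideanSpace ℝ (Fin d),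
        ∫⁻ z in Metric.ball x r,
          ENNReal.ofReal ((V (dist x z)) ^ 2 / (dist x z) ^ (d + 1) * ‖b z‖))
      (nhdsWithin (0 : ℝ) (Set.Ioi 0)) (nhds 0)) :
    Filter.Tendsto
      (fun R : ℝ => ⨆ y ∈ D,
        ∫⁻ z in {z | z ∈ D ∧ R < HQfun V D y z},
          ENNReal.ofReal (HQfun V D y z * ‖b z‖))
      Filter.atTop (nhds 0) := by
  have hnt : Nonempty (Fin d) := ⟨⟨0, by omega⟩⟩
  have hnt2 : Nontrivial (EuclideanSpace ℝ (Fin d)) := by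
    have : NeZero d := ⟨by omega⟩
    infer_instance
  have hDu : D ≠ univ := by
    rintro rfl
    exact NormedSpace.unbounded_univ ℝ (EuclideanSpace ℝ (Fin d)) hDbdd
  have hDc : Dᶜ.Nonempty := nonempty_compl.2 hDu
  have hδpos : ∀ z ∈ D, 0 < deltaD D z := fun z hz =>
    (hDopen.isClosed_compl.notMem_iff_infDist_pos hDc).1 (by simpa using hz)
  have hδc : Continuous (deltaD D) := continuous_infDist_pt _
  set L := Metric.diam D with hLdef
  have hL : 0 < L := by
    obtain ⟨x, hx⟩ := hDne
    have hnt3 : D.Nontrivial := by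
      by_contra h
      rw [Set.not_nontrivial_iff] at h
      have := h.eq_singleton_of_mem hx
      rw [this] at hDopen
      exact not_isOpen_singleton x hDopen
    exact Metric.diam_pos hnt3 hDbdd
  obtain ⟨C, hC0, hC⟩ := vol_global hd D hDopen hDu hDbdd r₀ hr₀ hC11 (2 * L) (by positivity)
  have hVdec := V_dec hd hVpos hVsub
  obtain ⟨C', hC'0, hC'⟩ := strip2 hd D hDopen L C hC0 hC V hVpos hVdec b hb
  set q : ℝ := (2 : ℝ) ^ (abar / 2 - 1) with hq
  have hq0 : 0 < q := by positivity
  have hq1 : q < 1 := Real.rpow_lt_one_of_one_lt_of_neg (by norm_num) (by linarith)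
  have hp1 : ((1:ℝ) / 2) ^ (α₁ / 2) < 1 :=
    Real.rpow_lt_one (by norm_num) (by norm_num) (by linarith)
  set K0 : ℝ := 2 ^ (d + 1) * C' * (2 * c₂ * Cbar) with hK0
  have hK0p : 0 < K0 := by positivity
  set G : ENNReal := (1 - ENNReal.ofReal q)⁻¹ with hG
  have hGt : G ≠ ⊤ := by
    rw [hG, ENNReal.inv_ne_top]
    exact (tsub_pos_of_lt (by simpa using hq1)).ne'
  set G2 : ENNReal := ENNReal.ofReal (2 ^ (α₁ / 2)) * (1 - ENNReal.ofReal ((1 / 2) ^ (α₁ / 2)))⁻¹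
    with hG2
  have hG2t : G2 ≠ ⊤ := by
    apply ENNReal.mul_ne_top ENNReal.ofReal_ne_top
    rw [ENNReal.inv_ne_top]
    exact (tsub_pos_of_lt (ENNReal.ofReal_lt_one.2 hp1)).ne'
  have main : ∀ (ρ : ℝ) (ε : ENNReal), 0 < ρ →
      (∀ x : EuclideanSpace ℝ (Fin d), ∫⁻ z in Metric.ball x ρ,
          ENNReal.ofReal ((V (dist x z)) ^ 2 / (dist x z) ^ (d + 1) * ‖b z‖) ≤ ε) →
      ∀ R : ℝ, (V ρ) ^ 2 / ρ ^ (d + 1) ≤ R → ∀ y ∈ D,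
        ∫⁻ z in {z | z ∈ D ∧ R < HQfun V D y z}, ENNReal.ofReal (HQfun V D y z * ‖b z‖) ≤
          (1 + ENNReal.ofReal K0 * G * G2) * ε := by
    intro ρ ε hρ hK R hR y hy
    have hR0 : 0 ≤ R := le_trans (by positivity) hR
    set a := deltaD D y with ha
    have ha0 : 0 < a := hδpos y hy
    let A1 : Set (EuclideanSpace ℝ (Fin d)) :=
      {z | z ∈ D ∧ 0 < dist y z ∧ dist y z ≤ deltaD D z ∧ dist y z < ρ}
    let cell : ℕ → ℕ → Set (EuclideanSpace ℝ (Fin d)) := fun k i =>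
      {z | z ∈ D ∧ L * (1 / 2) ^ (k + i) / 2 < deltaD D z ∧ deltaD D z ≤ L * (1 / 2) ^ (k + i) ∧
        L * (1 / 2) ^ k / 2 < dist y z ∧ dist y z ≤ L * (1 / 2) ^ k ∧
        deltaD D z < dist y z ∧ deltaD D z < ρ}
    have hdc : Continuous (fun z => dist y z) := continuous_const.dist continuous_id
    have hA1m : MeasurableSet A1 :=
      hDopen.measurableSet.inter (((isOpen_lt continuous_const hdc).measurableSet).inter
        (((isClosed_le hdc hδc).measurableSet).inter
          (isOpen_lt hdc continuous_const).measurableSet))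
    have hcm : ∀ k i, MeasurableSet (cell k i) := fun k i =>
      hDopen.measurableSet.inter (((isOpen_lt continuous_const hδc).measurableSet).inter
        (((isClosed_le hδc continuous_const).measurableSet).inter
        (((isOpen_lt continuous_const hdc).measurableSet).inter
        (((isClosed_le hdc continuous_const).measurableSet).inter
        (((isOpen_lt hδc hdc).measurableSet).inter
          (isOpen_lt hδc continuous_const).measurableSet)))))
    have hcover : {z | z ∈ D ∧ R < HQfun V D y z} ⊆ A1 ∪ ⋃ k, ⋃ i, cell k i := by
      rintro z ⟨hz, hRz⟩
      have hc0 := hδpos z hz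
      have hs0 : 0 < dist y z := by
        rw [dist_pos]
        rintro rfl
        have : HQfun V D y y = 0 := by simp [HQfun]
        linarith
      have hsL : dist y z ≤ L := dist_le_diam_of_mem hDbdd hy hz
      by_cases h : dist y z ≤ deltaD D z
      · left
        refine ⟨hz, hs0, h, ?_⟩
        by_contra hcon
        push Not at hcon
        have h1 := H_near (d := d) hVpos hVmono a (deltaD D z) (dist y z) ha0 hc0 hs0 h
        have h2 := hVdec ρ (dist y z) hρ hcon
        have h3 : HQfun V D y z ≤ (V (dist y z)) ^ 2 / (dist y z) ^ (d + 1) := h1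
        linarith
      · push Not at h
        right
        have hcρ : deltaD D z < ρ := by
          by_contra hcon
          push Not at hcon
          have h1 := H_far2 hd hVpos hVsub hVmono a (deltaD D z) (dist y z) ha0 hc0 hs0 h
          have h2 := hVdec ρ (deltaD D z) hρ hcon
          have h3 : HQfun V D y z ≤ (V (deltaD D z)) ^ 2 / (deltaD D z) ^ (d + 1) := h1
          linarith
        obtain ⟨k, hk1, hk2⟩ := exists_nat_pow_near_of_lt_one (x := dist y z / L) (y := 1 / 2)
          (by positivity) ((div_le_one hL).2 hsL) (by norm_num) (by norm_num)
        obtain ⟨j, hj1, hj2⟩ := exists_nat_pow_near_of_lt_one (x := deltaD D z / L) (y := 1 / 2)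
          (by positivity) ((div_le_one hL).2 (h.le.trans hsL)) (by norm_num) (by norm_num)
        have hkj : k < j + 1 := by
          have h1 : ((1:ℝ) / 2) ^ (j + 1) < (1 / 2) ^ k := by
            refine hj1.trans (lt_of_lt_of_le ?_ hk2)
            gcongr
          exact (pow_lt_pow_iff_right_of_lt_one₀ (by norm_num) (by norm_num)).1 h1
        obtain ⟨i, rfl⟩ := Nat.exists_eq_add_of_le (Nat.lt_succ_iff.1 hkj)
        rw [lt_div_iff₀ hL, pow_succ] at hk1 hj1
        rw [div_le_iff₀ hL] at hk2 hj2
        simp only [mem_iUnion]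
        exact ⟨k, i, hz, by linarith, by linarith, by linarith, by linarith, h, hcρ⟩
    have hA1 : ∫⁻ z in A1, ENNReal.ofReal (HQfun V D y z * ‖b z‖) ≤ ε := by
      refine le_trans (setLIntegral_mono' hA1m (g := fun z =>
        ENNReal.ofReal ((V (dist y z)) ^ 2 / (dist y z) ^ (d + 1) * ‖b z‖)) ?_) ?_
      · rintro z ⟨hz, hs0, h, -⟩
        apply ENNReal.ofReal_le_ofReal
        apply mul_le_mul_of_nonneg_right _ (norm_nonneg _)
        exact H_near (d := d) hVpos hVmono a (deltaD D z) (dist y z) ha0 (hδpos z hz) hs0 h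
      · refine le_trans (lintegral_mono_set ?_) (hK y)
        rintro z ⟨-, -, -, h⟩
        rwa [mem_ball, dist_comm]
    have hcell : ∀ k i, ∫⁻ z in cell k i, ENNReal.ofReal (HQfun V D y z * ‖b z‖) ≤
        (if a < 2 * (L * (1 / 2) ^ k) then
          ENNReal.ofReal ((a / (L * (1 / 2) ^ k)) ^ (α₁ / 2)) else 0) *
          (ENNReal.ofReal K0 * ε) * ENNReal.ofReal q ^ i := by
      intro k i
      rcases (cell k i).eq_empty_or_nonempty with he | ⟨z0, g1, g2, g3, g4, g5, g6, g7⟩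
      · rw [he]; simp
      set s := L * (1 / 2) ^ k with hs
      set t := L * (1 / 2) ^ (k + i) with ht
      have hs0 : 0 < s := by positivity
      have ht0 : 0 < t := by positivity
      have hst : t = s * (1 / 2) ^ i := by rw [ht, hs, pow_add]; ring
      have hts : t ≤ s := by
        rw [hst]
        exact mul_le_of_le_one_right hs0.le (pow_le_one₀ (by norm_num) (by norm_num))
      have hsL : s ≤ L := by
        rw [hs]
        exact mul_le_of_le_one_right hL.le (pow_le_one₀ (by norm_num) (by norm_num))
      have has : a < 2 * s := by
        have : deltaD D y ≤ deltaD D z0 + dist y z0 := infDist_le_infDist_add_dist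
        rw [← ha] at this
        linarith
      rw [if_pos has]
      have v1 := hVpos a ha0
      have v2 := hVpos t ht0
      set c : ℝ := 2 ^ (d + 1) * (V a * V t) / (s ^ d * t) with hc
      have hcp : 0 < c := by positivity
      calc ∫⁻ z in cell k i, ENNReal.ofReal (HQfun V D y z * ‖b z‖)
          ≤ ∫⁻ z in cell k i, ENNReal.ofReal c * ENNReal.ofReal ‖b z‖ := by
            apply setLIntegral_mono' (hcm k i)
            rintro z ⟨f1, f2, f3, f4, f5, f6, f7⟩
            rw [← ENNReal.ofReal_mul hcp.le]
            apply ENNReal.ofReal_le_ofReal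
            apply mul_le_mul_of_nonneg_right _ (norm_nonneg _)
            have hz0 := hδpos z f1
            have hd0 := hz0.trans f6
            have h1 : HQfun V D y z ≤ V a * V (deltaD D z) / (dist y z ^ d * deltaD D z) :=
              H_far (d := d) hVpos hVmono a (deltaD D z) (dist y z) ha0 hz0 hd0 f6
            refine h1.trans ?_
            have h2 : V (deltaD D z) ≤ V t := hVmono _ _ hz0.le f3
            have h3 : (s / 2) ^ d * (t / 2) ≤ dist y z ^ d * deltaD D z := by gcongr
            calc V a * V (deltaD D z) / (dist y z ^ d * deltaD D z)
                ≤ V a * V t / ((s / 2) ^ d * (t / 2)) := by gcongr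
              _ = c := by rw [hc, div_pow, pow_succ]; field_simp
        _ = ENNReal.ofReal c * ∫⁻ z in cell k i, ENNReal.ofReal ‖b z‖ :=
            lintegral_const_mul' _ _ ENNReal.ofReal_ne_top
        _ ≤ ENNReal.ofReal c * (ENNReal.ofReal (C' * s ^ (d - 1) * t ^ 2 / (V t) ^ 2) * ε) := by
            gcongr
            refine le_trans (lintegral_mono_set ?_)
              (hC' s t ρ ε y ht0 hts hsL (by linarith) hK)
            rintro z ⟨f1, f2, f3, f4, f5, f6, f7⟩
            exact ⟨f1, f2, f3, f5⟩
        _ = ENNReal.ofReal (c * (C' * s ^ (d - 1) * t ^ 2 / (V t) ^ 2)) * ε := by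
            rw [← mul_assoc, ← ENNReal.ofReal_mul hcp.le]
        _ ≤ ENNReal.ofReal ((a / s) ^ (α₁ / 2) * K0 * q ^ i) * ε := by
            refine mul_le_mul' (ENNReal.ofReal_le_ofReal ?_) le_rfl
            have h1 := V_cell hVpos hVsub hVmono L c₂ α₁ hc₂ hα₁ hVlow Cbar abar hCbar hVup
              a s t i ha0 hs0 hsL has hst
            have e : s ^ d = s ^ (d - 1) * s := by rw [← pow_succ]; congr 1; omega
            calc c * (C' * s ^ (d - 1) * t ^ 2 / (V t) ^ 2)
                = 2 ^ (d + 1) * C' * (V a * t / (s * V t)) := by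
                  rw [hc, e]; field_simp
              _ ≤ 2 ^ (d + 1) * C' * (2 * c₂ * Cbar * (a / s) ^ (α₁ / 2) * q ^ i) := by
                  gcongr
              _ = _ := by rw [hK0]; ring
        _ = _ := by
            rw [ENNReal.ofReal_mul (p := (a / s) ^ (α₁ / 2) * K0) (by positivity),
              ENNReal.ofReal_mul (p := (a / s) ^ (α₁ / 2)) (by positivity),
              ENNReal.ofReal_pow hq0.le]
            generalize ENNReal.ofReal ((a / s) ^ (α₁ / 2)) = x1
            generalize ENNReal.ofReal K0 = x2
            generalize ENNReal.ofReal q ^ i = x3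
            ring
    calc ∫⁻ z in {z | z ∈ D ∧ R < HQfun V D y z}, ENNReal.ofReal (HQfun V D y z * ‖b z‖)
        ≤ ∫⁻ z in A1 ∪ ⋃ k, ⋃ i, cell k i, ENNReal.ofReal (HQfun V D y z * ‖b z‖) :=
          lintegral_mono_set hcover
      _ ≤ (∫⁻ z in A1, ENNReal.ofReal (HQfun V D y z * ‖b z‖)) +
          ∫⁻ z in ⋃ k, ⋃ i, cell k i, ENNReal.ofReal (HQfun V D y z * ‖b z‖) :=
          lintegral_union_le _ _ _
      _ ≤ ε + ∑' k, ∑' i, (if a < 2 * (L * (1 / 2) ^ k) then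
          ENNReal.ofReal ((a / (L * (1 / 2) ^ k)) ^ (α₁ / 2)) else 0) *
          (ENNReal.ofReal K0 * ε) * ENNReal.ofReal q ^ i := by
          refine add_le_add hA1 ((lintegral_iUnion_le _ _).trans ?_)
          refine ENNReal.tsum_le_tsum fun k => (lintegral_iUnion_le _ _).trans ?_
          exact ENNReal.tsum_le_tsum fun i => hcell k i
      _ = ε + (∑' k, (if a < 2 * (L * (1 / 2) ^ k) then
          ENNReal.ofReal ((a / (L * (1 / 2) ^ k)) ^ (α₁ / 2)) else 0)) *
          (ENNReal.ofReal K0 * ε) * G := by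
          simp_rw [ENNReal.tsum_mul_left, ENNReal.tsum_geometric, ENNReal.tsum_mul_right]
          rw [hG]
      _ ≤ ε + G2 * (ENNReal.ofReal K0 * ε) * G := by
          gcongr
          exact sum_k a L (α₁ / 2) ha0 hL (by linarith)
      _ = _ := by ring
  have hKt : (1 + ENNReal.ofReal K0 * G * G2) ≠ ⊤ :=
    ENNReal.add_ne_top.2 ⟨ENNReal.one_ne_top,
      ENNReal.mul_ne_top (ENNReal.mul_ne_top ENNReal.ofReal_ne_top hGt) hG2t⟩
  have hKz : (1 + ENNReal.ofReal K0 * G * G2) ≠ 0 := by simp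
  rw [ENNReal.tendsto_nhds_zero] at hKato ⊢
  intro η hη
  have h1 := hKato (η / (1 + ENNReal.ofReal K0 * G * G2)) (ENNReal.div_pos hη.ne' hKt)
  obtain ⟨ρ, hρ1, hρ2⟩ := (h1.and self_mem_nhdsWithin).exists
  filter_upwards [eventually_ge_atTop ((V ρ) ^ 2 / ρ ^ (d + 1))] with R hR
  refine iSup₂_le fun y hy => ?_
  refine (main ρ _ hρ2 (fun x => (le_iSup _ x).trans hρ1) R hR y hy).trans ?_
  rw [ENNReal.mul_div_cancel hKz hKt]

end
end

section
/- Let d ≥ 2 and let D ⊆ ℝ^d be a nonempty bounded open set. Let V : [0,∞) → [0,∞) be nondecreasing with V(0)=0, V(r) > 0 for r > 0, V(λr) ≤ λ V(r) for all λ ≥ 1, and suppose there are constants c₂ ≥ 1 and α₁ ≥ 1 with V(ηr) ≤ c₂ η^{α₁/2} V(r) for all 0 < η ≤ 1 and 0 < r ≤ diam(D). Let b : ℝ^d → ℝ^d be measurable and set K_R = sup_{x∈ℝ^d} ∫_{B(x,R)} V(|x−z|)²/|x−z|^{d+1} · |b(z)| dz. Define U(s) = V(s)²/s^d and H(x,y)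 = U(|x−y|) V(δ_D(x)) V(δ_D(y)) / V(r(x,y))². Then there is a constant C = C(d, c₂) such that for all x, y ∈ D with x ≠ y: ∫_D |b(z)| · H(x,z) H(z,y) / ( H(x,y) · ( δ_D(z) ∧ |x−z| ∧ |y−z| ) ) dz ≤ C · K_{diam(D)}. -/
open Metric MeasureTheory Filter Set

noncomputable section

lemma kappa_key (d : ℕ) (hd : 2 ≤ d) (c₂ : ℝ) (hc₂ : 1 ≤ c₂) (V : ℝ → ℝ) (L : ℝ)
    (hmono : ∀ r s : ℝ, 0 ≤ r → r ≤ s → V r ≤ V s)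
    (hpos : ∀ r : ℝ, 0 < r → 0 < V r)
    (hsc : ∀ lam r : ℝ, 1 ≤ lam → 0 ≤ r → V (lam * r) ≤ lam * V r)
    (α₁ : ℝ) (hα : 1 ≤ α₁)
    (hw : ∀ η r : ℝ, 0 < η → η ≤ 1 → 0 < r → r ≤ L → V (η * r) ≤ c₂ * η ^ (α₁ / 2) * V r)
    (a c s p q w : ℝ) (ha : 0 < a) (hs : 0 < s) (hp : 0 < p) (hq : 0 < q)
    (hw0 : 0 < w) (hac : a ≤ c) (hsac : s ≤ a + c) (hpw : p ≤ w + a) (haL : a ≤ L) :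
    (Ufun d V a * (V p * V w) / V (max (max p w) a) ^ 2) *
      (Ufun d V c * (V w * V q) / V (max (max w q) c) ^ 2) /
      (Ufun d V s * (V p * V q) / V (max (max p q) s) ^ 2 * min w (min a c)) ≤
    (2 ^ d * 4 * c₂ ^ 2) * (V a ^ 2 / a ^ (d + 1)) := by
  have hc : 0 < c := ha.trans_le hac
  have hR1 : 0 < max (max p w) a := lt_max_of_lt_right ha
  have hR2 : 0 < max (max w q) c := lt_max_of_lt_right hc
  have hR : 0 < max (max p q) s := lt_max_of_lt_right hs
  have hwR1 : w ≤ max (max p w) a := le_max_of_le_left (le_max_right _ _)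
  have haR1 : a ≤ max (max p w) a := le_max_right _ _
  have hRR2 : max (max p q) s ≤ 2 * max (max w q) c := by
    have h1 : w ≤ max (max w q) c := le_max_of_le_left (le_max_left _ _)
    have h2 : q ≤ max (max w q) c := le_max_of_le_left (le_max_right _ _)
    have h3 : c ≤ max (max w q) c := le_max_right _ _
    refine max_le (max_le ?_ ?_) ?_ <;> linarith
  rw [min_eq_left hac]
  generalize max (max p w) a = R1 at *
  generalize max (max w q) c = R2 at *
  generalize max (max p q) s = R at *
  have hm : 0 < min w a := lt_min hw0 ha
  have Va := hpos a ha
  have Vc := hpos c hc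
  have Vs := hpos s hs
  have Vp := hpos p hp
  have Vq := hpos q hq
  have Vw := hpos w hw0
  have VR1 := hpos R1 hR1
  have VR2 := hpos R2 hR2
  have VR := hpos R hR
  have e1 : V R ^ 2 / V R2 ^ 2 ≤ 4 := by
    rw [div_le_iff₀ (by positivity)]
    have : V R ≤ 2 * V R2 := (hmono _ _ hR.le hRR2).trans (hsc 2 R2 (by norm_num) hR2.le)
    nlinarith
  have e2 : (V c ^ 2 / c ^ d) / (V s ^ 2 / s ^ d) ≤ 2 ^ d := by
    rw [div_le_iff₀ (by positivity)]
    rcases le_total s c with h | h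
    · have h1 : V c ≤ (c / s) * V s := by
        have := hsc (c / s) s ((one_le_div hs).2 h) hs.le
        rwa [div_mul_cancel₀ _ hs.ne'] at this
      have h2 : V c ^ 2 / c ^ d ≤ V s ^ 2 / s ^ d := by
        obtain ⟨k, rfl⟩ := Nat.exists_eq_add_of_le hd
        have h3 : s ^ k ≤ c ^ k := pow_le_pow_left₀ hs.le h k
        calc V c ^ 2 / c ^ (2 + k) ≤ ((c / s) * V s) ^ 2 / c ^ (2 + k) := by gcongr
          _ = V s ^ 2 / (s ^ 2 * c ^ k) := by rw [pow_add]; field_simp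
          _ ≤ V s ^ 2 / (s ^ 2 * s ^ k) := by gcongr
          _ = _ := by rw [pow_add]
      have h4 : (1:ℝ) ≤ 2 ^ d := one_le_pow₀ (by norm_num)
      have h5 : 0 ≤ V s ^ 2 / s ^ d := by positivity
      nlinarith
    · have h1 := hmono _ _ hc.le h
      have h2 : s ^ d ≤ 2 ^ d * c ^ d := by
        rw [← mul_pow]; exact pow_le_pow_left₀ hs.le (by linarith) d
      calc V c ^ 2 / c ^ d ≤ V s ^ 2 / c ^ d := by gcongr
        _ = V s ^ 2 * 2 ^ d / (2 ^ d * c ^ d) := by field_simp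
        _ ≤ V s ^ 2 * 2 ^ d / s ^ d := by gcongr
        _ = _ := by ring
  have e3 : V w ^ 2 / (V R1 ^ 2 * min w a) ≤ c₂ ^ 2 / a := by
    rcases le_total a w with h | h
    · rw [min_eq_right h, div_le_div_iff₀ (by positivity) ha]
      have h1 := hmono _ _ hw0.le hwR1
      have h2 : V w ^ 2 ≤ V R1 ^ 2 := by gcongr
      have h3 : V R1 ^ 2 ≤ c₂ ^ 2 * V R1 ^ 2 := by
        have : 1 ≤ c₂ ^ 2 := one_le_pow₀ hc₂
        nlinarith [sq_nonneg (V R1)]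
      nlinarith
    · rw [min_eq_left h, div_le_div_iff₀ (by positivity) ha]
      have h0 : 0 < w / a := by positivity
      have h0' : w / a ≤ 1 := (div_le_one ha).2 h
      have h1 := hw (w / a) a h0 h0' ha haL
      rw [div_mul_cancel₀ _ ha.ne'] at h1
      have h2 : ((w / a) ^ (α₁ / 2)) ^ 2 ≤ w / a := by
        rw [← Real.rpow_natCast, ← Real.rpow_mul h0.le]
        have : (w / a) ^ (α₁ / 2 * ((2 : ℕ) : ℝ)) ≤ (w / a) ^ (1 : ℝ) :=
          Real.rpow_le_rpow_of_exponent_ge h0 h0' (by push_cast; linarith)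
        simpa using this
      have h3 : V w ^ 2 ≤ c₂ ^ 2 * (w / a) * V R1 ^ 2 := by
        calc V w ^ 2 ≤ (c₂ * (w / a) ^ (α₁ / 2) * V a) ^ 2 := by gcongr
          _ = c₂ ^ 2 * ((w / a) ^ (α₁ / 2)) ^ 2 * V a ^ 2 := by ring
          _ ≤ c₂ ^ 2 * (w / a) * V R1 ^ 2 := by
            have := hmono _ _ ha.le haR1
            gcongr
      calc V w ^ 2 * a ≤ (c₂ ^ 2 * (w / a) * V R1 ^ 2) * a := by gcongr
        _ = _ := by field_simp
  unfold Ufun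
  generalize min w a = m at *
  calc _ = (V a ^ 2 / a ^ d) * (((V c ^ 2 / c ^ d) / (V s ^ 2 / s ^ d)) *
        (V R ^ 2 / V R2 ^ 2) * (V w ^ 2 / (V R1 ^ 2 * m))) := by field_simp
    _ ≤ (V a ^ 2 / a ^ d) * (2 ^ d * 4 * (c₂ ^ 2 / a)) := by gcongr
    _ = _ := by rw [pow_succ a d]; field_simp

lemma Hfun_symm {d : ℕ} (V : ℝ → ℝ) (D : Set (EuclideanSpace ℝ (Fin d)))
    (x y : EuclideanSpace ℝ (Fin d)) : Hfun V D x y = Hfun V D y x := by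
  unfold Hfun rD
  rw [dist_comm, mul_comm (V (deltaD D x)), max_comm (deltaD D x)]

lemma dist_lt_diam_of_open {d : ℕ} (D : Set (EuclideanSpace ℝ (Fin d))) (ho : IsOpen D)
    (hb : Bornology.IsBounded D) (x z : EuclideanSpace ℝ (Fin d)) (hx : x ∈ D) (hz : z ∈ D)
    (hxz : x ≠ z) : dist x z < Metric.diam D := by
  have hcont : Continuous (fun t : ℝ => x + t • (x - z)) := by fun_prop
  have hmem : ∀ᶠ t in nhds (0:ℝ), x + t • (x - z) ∈ D :=
    hcont.continuousAt.eventually_mem (by simpa using ho.mem_nhds hx)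
  obtain ⟨ε, hε, h⟩ := Metric.eventually_nhds_iff.1 hmem
  have h1 := h (y := ε / 2) (by rw [Real.dist_eq, sub_zero, abs_of_pos (by positivity)]; linarith)
  have h2 := Metric.dist_le_diam_of_mem hb h1 hz
  have h3 : dist (x + (ε / 2) • (x - z)) z = (1 + ε / 2) * dist x z := by
    rw [dist_eq_norm, dist_eq_norm, show x + (ε / 2) • (x - z) - z = (1 + ε / 2) • (x - z) by module,
      norm_smul, Real.norm_of_nonneg (by positivity)]
  have h4 : 0 < dist x z := dist_pos.2 hxz
  rw [h3] at h2
  nlinarith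

/-- Lemma 3.8 (analytic content): `κ(x,y)` is bounded by `C·K_{diam D}` with
`C = C(d, c₂)`. -/
theorem kappa_bounded {d : ℕ} (hd : 2 ≤ d) (c₂ : ℝ) (hc₂ : 1 ≤ c₂) :
    ∃ C : ℝ, 0 < C ∧
      ∀ (D : Set (EuclideanSpace ℝ (Fin d))), D.Nonempty → IsOpen D →
        Bornology.IsBounded D →
      ∀ V : ℝ → ℝ,
        (∀ r s : ℝ, 0 ≤ r → r ≤ s → V r ≤ V s) →
        V 0 = 0 →
        (∀ r : ℝ, 0 < r → 0 < V r) →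
        (∀ lam r : ℝ, 1 ≤ lam → 0 ≤ r → V (lam * r) ≤ lam * V r) →
      ∀ α₁ : ℝ, 1 ≤ α₁ →
        (∀ η r : ℝ, 0 < η → η ≤ 1 → 0 < r → r ≤ Metric.diam D →
          V (η * r) ≤ c₂ * η ^ (α₁ / 2) * V r) →
      ∀ b : EuclideanSpace ℝ (Fin d) → EuclideanSpace ℝ (Fin d), Measurable b →
      ∀ K : ℝ → ENNReal,
        (∀ R : ℝ, K R = ⨆ x : EuclideanSpace ℝ (Fin d),
          ∫⁻ z in Metric.ball x R,
            ENNReal.ofReal ((V (dist x z)) ^ 2 / (dist x z) ^ (d + 1) * ‖b z‖)) →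
      ∀ x y : EuclideanSpace ℝ (Fin d), x ∈ D → y ∈ D → x ≠ y →
        (∫⁻ z in D, ENNReal.ofReal (‖b z‖ * (Hfun V D x z * Hfun V D z y) /
            (Hfun V D x y * min (deltaD D z) (min (dist x z) (dist y z))))) ≤
          ENNReal.ofReal C * K (Metric.diam D) := by
  refine ⟨2 ^ d * 4 * c₂ ^ 2 * 2, by positivity, ?_⟩
  intro D hne ho hb V hmono hV0 hpos hsc α₁ hα hw b hbm K hK x y hx hy hxy
  have : Nontrivial (EuclideanSpace ℝ (Fin d)) := ⟨x, y, hxy⟩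
  have hcne : (Dᶜ).Nonempty := by
    rw [Set.nonempty_compl]
    rintro rfl
    exact NormedSpace.unbounded_univ ℝ (EuclideanSpace ℝ (Fin d)) hb
  have hδ : ∀ z ∈ D, 0 < deltaD D z := fun z hz =>
    (ho.isClosed_compl.notMem_iff_infDist_pos hcne).1 (by simpa using hz)
  have hδt : ∀ u v, deltaD D u ≤ deltaD D v + dist u v := fun u v =>
    Metric.infDist_le_infDist_add_dist
  have hVn : ∀ r, 0 ≤ r → 0 ≤ V r := fun r hr => by
    have := hmono 0 r le_rfl hr
    rwa [hV0] at this
  set F : EuclideanSpace ℝ (Fin d) → EuclideanSpace ℝ (Fin d) → ℝ :=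
    fun u z => V (dist u z) ^ 2 / dist u z ^ (d + 1) with hF
  have hF0 : ∀ u z, 0 ≤ F u z := fun u z => by positivity
  have hA : 0 ≤ 2 ^ d * 4 * c₂ ^ 2 := by positivity
  have half : ∀ x y z, x ∈ D → y ∈ D → z ∈ D → x ≠ y → x ≠ z → dist x z ≤ dist y z →
      Hfun V D x z * Hfun V D z y / (Hfun V D x y * min (deltaD D z) (min (dist x z) (dist y z)))
        ≤ (2 ^ d * 4 * c₂ ^ 2) * F x z := by
    intro x y z hx hy hz hxy hxz hle
    have := kappa_key d hd c₂ hc₂ V (Metric.diam D) hmono hpos hsc α₁ hα hw (dist x z) (dist y z)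
      (dist x y) (deltaD D x) (deltaD D y) (deltaD D z) (dist_pos.2 hxz) (dist_pos.2 hxy)
      (hδ x hx) (hδ y hy) (hδ z hz) hle
      (by rw [dist_comm y z]; exact dist_triangle _ _ _) (hδt x z)
      (Metric.dist_le_diam_of_mem hb hx hz)
    simpa only [Hfun, rD, dist_comm z y] using this
  have hpt : ∀ z ∈ D, ‖b z‖ * (Hfun V D x z * Hfun V D z y) /
      (Hfun V D x y * min (deltaD D z) (min (dist x z) (dist y z))) ≤
      (2 ^ d * 4 * c₂ ^ 2) * (F x z * ‖b z‖ + F y z * ‖b z‖) := by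
    intro z hz
    have hb0 := norm_nonneg (b z)
    have hx0 := mul_nonneg hA (mul_nonneg (hF0 x z) hb0)
    have hy0 := mul_nonneg hA (mul_nonneg (hF0 y z) hb0)
    by_cases hxz : x = z
    · subst hxz
      simp only [dist_self, min_eq_left (dist_nonneg (x := y) (y := x)), min_eq_right (hδ x hx).le, mul_zero, div_zero]
      linarith
    by_cases hyz : y = z
    · subst hyz
      simp only [dist_self, min_eq_right (dist_nonneg (x := x) (y := y)), min_eq_right (hδ y hy).le, mul_zero, div_zero]
      linarith
    rw [mul_div_assoc]
    rcases le_total (dist x z) (dist y z) with h | h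
    · have := mul_le_mul_of_nonneg_left (half x y z hx hy hz hxy hxz h) hb0
      linarith
    · have h1 := half y x z hy hx hz hxy.symm hyz h
      rw [Hfun_symm V D y z, Hfun_symm V D z x, Hfun_symm V D y x, mul_comm (Hfun V D z y),
        min_comm (dist y z)] at h1
      have := mul_le_mul_of_nonneg_left h1 hb0
      linarith
  have hVm : Measurable (fun r => V (max r 0)) :=
    Monotone.measurable fun r s h => hmono _ _ (le_max_right _ _) (max_le_max_right 0 h)
  have hFm : ∀ u, Measurable (fun z => ENNReal.ofReal (F u z * ‖b z‖)) := by
    intro u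
    have h1 : Measurable (fun z => dist u z) := measurable_const.dist measurable_id
    have h2 : Measurable (fun z => V (dist u z)) := by
      have := hVm.comp h1
      simpa [Function.comp_def] using this
    exact (((h2.pow_const 2).div (h1.pow_const _)).mul hbm.norm).ennreal_ofReal
  have hI : ∀ u ∈ D, ∫⁻ z in D, ENNReal.ofReal (F u z * ‖b z‖) ≤ K (Metric.diam D) := by
    intro u hu
    rw [hK]
    refine le_trans ?_ (le_iSup _ u)
    refine lintegral_mono_set fun z hz => ?_
    rw [Metric.mem_ball, dist_comm]
    by_cases h : u = z
    · subst h
      rw [dist_self]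
      exact lt_of_lt_of_le (dist_pos.2 hxy) (Metric.dist_le_diam_of_mem hb hx hy)
    · exact dist_lt_diam_of_open D ho hb u z hu hz h
  calc _ ≤ ∫⁻ z in D, ENNReal.ofReal (2 ^ d * 4 * c₂ ^ 2) *
        (ENNReal.ofReal (F x z * ‖b z‖) + ENNReal.ofReal (F y z * ‖b z‖)) := by
        refine setLIntegral_mono' ho.measurableSet fun z hz => ?_
        rw [← ENNReal.ofReal_add (mul_nonneg (hF0 _ _) (norm_nonneg _))
          (mul_nonneg (hF0 _ _) (norm_nonneg _)), ← ENNReal.ofReal_mul hA]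
        exact ENNReal.ofReal_le_ofReal (hpt z hz)
    _ = ENNReal.ofReal (2 ^ d * 4 * c₂ ^ 2) * ((∫⁻ z in D, ENNReal.ofReal (F x z * ‖b z‖)) +
        ∫⁻ z in D, ENNReal.ofReal (F y z * ‖b z‖)) := by
        rw [lintegral_const_mul' _ _ ENNReal.ofReal_ne_top, lintegral_add_left (hFm x)]
    _ ≤ ENNReal.ofReal (2 ^ d * 4 * c₂ ^ 2) * (K (Metric.diam D) + K (Metric.diam D)) := by
        gcongr
        · exact hI x hx
        · exact hI y hy
    _ = _ := by
        rw [ENNReal.ofReal_mul hA, ENNReal.ofReal_ofNat, ← two_mul (K _), ← mul_assoc]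


end
end

section
/- Let d ≥ 2 and let D ⊆ ℝ^d be a nonempty open set. Suppose V : [0,∞) → [0,∞) is nondecreasing, V(0)=0, V(r) > 0 for r > 0, and V(λr) ≤ λ V(r) for all λ ≥ 1, r ≥ 0. Define U(s) = V(s)²/s^d and 𝒢(x,y) = U(|x−y|)/V(r(x,y))². Then for all pairwise distinct x, y, z ∈ D: min( 𝒢(x,z), 𝒢(z,y) ) ≤ 9·2^d · 𝒢(x,y). -/
open Metric MeasureTheory Filter Set

noncomputable section

/-- `𝒢(x,y) = U(|x−y|)/V(r(x,y))²`. -/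
def Gfun {d : ℕ} (V : ℝ → ℝ) (D : Set (EuclideanSpace ℝ (Fin d)))
    (x y : EuclideanSpace ℝ (Fin d)) : ℝ :=
  Ufun d V (dist x y) / (V (rD D x y)) ^ 2

lemma aux_U {d : ℕ} (hd : 2 ≤ d) (V : ℝ → ℝ)
    (hVmono : ∀ r s : ℝ, 0 ≤ r → r ≤ s → V r ≤ V s)
    (hVpos : ∀ r : ℝ, 0 < r → 0 < V r)
    (hVscal : ∀ lam r : ℝ, 1 ≤ lam → 0 ≤ r → V (lam * r) ≤ lam * V r)
    (a t : ℝ) (ha : 0 < a) (ht : 0 < t) (hta : t ≤ 2 * a) :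
    Ufun d V a ≤ 2 ^ d * Ufun d V t := by
  unfold Ufun
  have hVa := hVpos a ha
  have hVt := hVpos t ht
  rw [← mul_div_assoc, div_le_div_iff₀ (by positivity) (by positivity)]
  rcases le_total a t with h | h
  · have h1 : V a ^ 2 ≤ V t ^ 2 := pow_le_pow_left₀ hVa.le (hVmono a t ha.le h) 2
    have h2 : t ^ d ≤ (2 * a) ^ d := pow_le_pow_left₀ ht.le hta d
    calc V a ^ 2 * t ^ d ≤ V t ^ 2 * (2 * a) ^ d := by gcongr
      _ = 2 ^ d * V t ^ 2 * a ^ d := by rw [mul_pow]; ring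
  · have h0 : V a ≤ a / t * V t := by
      have := hVscal (a / t) t (by rwa [one_le_div ht]) ht.le
      rwa [div_mul_cancel₀ _ ht.ne'] at this
    have h1 : V a * t ≤ a * V t := by
      rw [div_mul_eq_mul_div, le_div_iff₀ ht] at h0
      exact h0
    obtain ⟨k, rfl⟩ := Nat.exists_eq_add_of_le hd
    have h2 : t ^ k ≤ a ^ k := pow_le_pow_left₀ ht.le h k
    have h3 : (1 : ℝ) ≤ 2 ^ (2 + k) := one_le_pow₀ (by norm_num)
    calc V a ^ 2 * t ^ (2 + k) = (V a * t) ^ 2 * t ^ k := by ring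
      _ ≤ (a * V t) ^ 2 * a ^ k := by gcongr
      _ = 1 * (V t ^ 2 * a ^ (2 + k)) := by ring
      _ ≤ 2 ^ (2 + k) * (V t ^ 2 * a ^ (2 + k)) := by gcongr
      _ = 2 ^ (2 + k) * V t ^ 2 * a ^ (2 + k) := by ring

lemma aux_G {d : ℕ} (hd : 2 ≤ d)
    (D : Set (EuclideanSpace ℝ (Fin d))) (V : ℝ → ℝ)
    (hVmono : ∀ r s : ℝ, 0 ≤ r → r ≤ s → V r ≤ V s)
    (hVpos : ∀ r : ℝ, 0 < r → 0 < V r)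
    (hVscal : ∀ lam r : ℝ, 1 ≤ lam → 0 ≤ r → V (lam * r) ≤ lam * V r)
    (x y z : EuclideanSpace ℝ (Fin d))
    (hxy : x ≠ y) (hxz : x ≠ z) (h : dist x y ≤ 2 * dist x z) :
    Gfun V D x z ≤ 9 * 2 ^ d * Gfun V D x y := by
  have ht := dist_pos.2 hxy
  have ha := dist_pos.2 hxz
  have hU := aux_U hd V hVmono hVpos hVscal _ _ ha ht h
  have hrz : dist x z ≤ rD D x z := le_max_right _ _
  have hry : dist x y ≤ rD D x y := le_max_right _ _
  have hδ : deltaD D x ≤ rD D x z := (le_max_left _ _).trans (le_max_left _ _)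
  have hL : deltaD D y ≤ deltaD D x + dist y x := Metric.infDist_le_infDist_add_dist
  rw [dist_comm y x] at hL
  have hr : rD D x y ≤ 3 * rD D x z := by
    have h0 : 0 ≤ deltaD D x := Metric.infDist_nonneg
    refine max_le (max_le ?_ ?_) ?_ <;> linarith
  have hV : V (rD D x y) ≤ 3 * V (rD D x z) :=
    (hVmono _ _ (by linarith) hr).trans (hVscal 3 _ (by norm_num) (by linarith))
  have p1 := hVpos _ (ht.trans_le hry)
  have p2 := hVpos _ (ha.trans_le hrz)
  have p3 := hVpos _ ht
  have hUt : 0 ≤ Ufun d V (dist x y) := by unfold Ufun; positivity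
  have hUa : 0 ≤ Ufun d V (dist x z) := by unfold Ufun; positivity
  unfold Gfun
  rw [← mul_div_assoc, div_le_div_iff₀ (by positivity) (by positivity)]
  calc Ufun d V (dist x z) * V (rD D x y) ^ 2
      ≤ (2 ^ d * Ufun d V (dist x y)) * (3 * V (rD D x z)) ^ 2 := by gcongr
    _ = _ := by ring

lemma aux_symm {d : ℕ} (V : ℝ → ℝ) (D : Set (EuclideanSpace ℝ (Fin d)))
    (x y : EuclideanSpace ℝ (Fin d)) : Gfun V D x y = Gfun V D y x := by
  unfold Gfun rD
  rw [dist_comm x y, max_comm (deltaD D x)]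

/-- Quasi-metric type inequality for `𝒢`. -/
theorem quasi_metric_G {d : ℕ} (hd : 2 ≤ d)
    (D : Set (EuclideanSpace ℝ (Fin d))) (hDne : D.Nonempty) (hDopen : IsOpen D)
    (V : ℝ → ℝ)
    (hVmono : ∀ r s : ℝ, 0 ≤ r → r ≤ s → V r ≤ V s)
    (hV0 : V 0 = 0)
    (hVpos : ∀ r : ℝ, 0 < r → 0 < V r)
    (hVscal : ∀ lam r : ℝ, 1 ≤ lam → 0 ≤ r → V (lam * r) ≤ lam * V r)
    (x y z : EuclideanSpace ℝ (Fin d)) (hx : x ∈ D) (hy : y ∈ D) (hz : z ∈ D)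
    (hxy : x ≠ y) (hxz : x ≠ z) (hyz : y ≠ z) :
    min (Gfun V D x z) (Gfun V D z y) ≤ 9 * 2 ^ d * Gfun V D x y := by
  have tri := dist_triangle x z y
  rcases le_total (dist z y) (dist x z) with h | h
  · exact (min_le_left _ _).trans
      (aux_G hd D V hVmono hVpos hVscal x y z hxy hxz (by linarith))
  · refine (min_le_right _ _).trans ?_
    rw [aux_symm V D z y, aux_symm V D x y]
    refine aux_G hd D V hVmono hVpos hVscal y x z hxy.symm hyz ?_
    rw [dist_comm y x, dist_comm y z]
    linarith

end
end

section
/- Let D ⊆ ℝ^d be a nonempty bounded open set and let V : [0,∞) → [0,∞) be nondecreasing with V(0)=0, V(r) > 0 for r > 0. Suppose there are constants c₂ ≥ 1 and α₁ with 1 < α₁ < 2 such that V(ηr) ≤ c₂ η^{α₁/2} V(r) for all 0 < η ≤ 1 and 0 < r ≤ diam(D). Let m ≥ 1. Then for all y, z ∈ D with y ≠ z and δ_D(y) ≤ m·δ_D(z): ( V(δ_D(y)) V(δ_D(z)) / V(r(y,z))² ) · ( (δ_D(z) ∨ |y−z|) / δ_D(z) ) ≤ c₂² · m^{1 − α₁/2}.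 -/
open Metric MeasureTheory Filter Set

noncomputable section

/-- Estimate (3.8): bound for `H(y,z)·|y−z|/U(y−z)` on `{δ_D(y) ≤ m·δ_D(z)}`. -/
theorem H_bound_on_good_region {d : ℕ}
    (D : Set (EuclideanSpace ℝ (Fin d))) (hDne : D.Nonempty) (hDopen : IsOpen D)
    (hDbdd : Bornology.IsBounded D)
    (V : ℝ → ℝ)
    (hVmono : ∀ r s : ℝ, 0 ≤ r → r ≤ s → V r ≤ V s)
    (hV0 : V 0 = 0)
    (hVpos : ∀ r : ℝ, 0 < r → 0 < V r)
    (c₂ α₁ : ℝ) (hc₂ : 1 ≤ c₂) (hα₁ : 1 < α₁) (hα₁' : α₁ < 2)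
    (hVscal : ∀ η r : ℝ, 0 < η → η ≤ 1 → 0 < r → r ≤ Metric.diam D →
      V (η * r) ≤ c₂ * η ^ (α₁ / 2) * V r)
    (m : ℝ) (hm : 1 ≤ m)
    (y z : EuclideanSpace ℝ (Fin d)) (hy : y ∈ D) (hz : z ∈ D) (hyz : y ≠ z)
    (hδ : deltaD D y ≤ m * deltaD D z) :
    V (deltaD D y) * V (deltaD D z) / (V (rD D y z)) ^ 2 *
        (max (deltaD D z) (dist y z) / deltaD D z) ≤
      c₂ ^ 2 * m ^ (1 - α₁ / 2) := by
  have hnt : Nontrivial (EuclideanSpace ℝ (Fin d)) := ⟨y, z, hyz⟩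
  have hne : (Dᶜ).Nonempty := by
    rw [Set.nonempty_compl]
    rintro rfl
    exact NormedSpace.unbounded_univ ℝ (EuclideanSpace ℝ (Fin d)) hDbdd
  have hcl : IsClosed Dᶜ := hDopen.isClosed_compl
  have hpos : ∀ x ∈ D, 0 < deltaD D x := fun x hx =>
    (hcl.notMem_iff_infDist_pos hne).1 (by simpa using hx)
  have hdiam : ∀ x ∈ D, ∀ w ∈ D, x ≠ w → deltaD D x ≤ Metric.diam D := by
    intro x hx w hw hxw
    have hn : 0 < ‖x - w‖ := norm_pos_iff.2 (sub_ne_zero.2 hxw)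
    apply le_of_forall_lt
    intro s0 hs0
    obtain ⟨s, hs1, hs2⟩ := exists_between (max_lt hs0 (hpos x hx))
    have hs0s : s0 < s := lt_of_le_of_lt (le_max_left _ _) hs1
    have hsp : 0 < s := lt_of_le_of_lt (le_max_right _ _) hs1
    have hd : dist (x + (s / ‖x - w‖) • (x - w)) x = s := by
      rw [dist_eq_norm, add_sub_cancel_left, norm_smul, Real.norm_of_nonneg (by positivity)]
      field_simp
    have hmem : x + (s / ‖x - w‖) • (x - w) ∈ D := by
      apply Metric.ball_infDist_compl_subset (x := x)
      rw [Metric.mem_ball, hd]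
      exact hs2
    have := Metric.dist_le_diam_of_mem hDbdd hmem hx
    linarith
  have ha := hpos y hy
  have hb := hpos z hz
  have hrd : rD D y z ≤ Metric.diam D :=
    max_le (max_le (hdiam y hy z hz hyz) (hdiam z hz y hy hyz.symm))
      (Metric.dist_le_diam_of_mem hDbdd hy hz)
  have har : deltaD D y ≤ rD D y z := le_trans (le_max_left _ _) (le_max_left _ _)
  have hbr : deltaD D z ≤ rD D y z := le_trans (le_max_right _ _) (le_max_left _ _)
  have hwr : max (deltaD D z) (dist y z) ≤ rD D y z := max_le hbr (le_max_right _ _)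
  have hw : 0 < max (deltaD D z) (dist y z) := lt_max_of_lt_left hb
  generalize max (deltaD D z) (dist y z) = w at *
  generalize rD D y z = r at *
  generalize deltaD D y = a at *
  generalize deltaD D z = b at *
  have hr : 0 < r := lt_of_lt_of_le ha har
  have hVr := hVpos r hr
  have hx0 : 0 < a / r := by positivity
  have hu0 : 0 < b / r := by positivity
  have hx1 : a / r ≤ 1 := (div_le_one hr).2 har
  have hu1 : b / r ≤ 1 := (div_le_one hr).2 hbr
  have h1 := hVscal (a / r) r hx0 hx1 hr hrd
  have h2 := hVscal (b / r) r hu0 hu1 hr hrd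
  rw [div_mul_cancel₀ _ hr.ne'] at h1 h2
  have hxu : a / r ≤ m * (b / r) := by
    rw [← mul_div_assoc]; gcongr
  have hwb : w / b ≤ (b / r)⁻¹ := by
    rw [inv_div]; gcongr
  generalize a / r = x at *
  generalize b / r = u at *
  have hVa := hVpos a ha
  have hVb := hVpos b hb
  have hm0 : 0 < m := by linarith
  have h3 : x ^ (α₁ / 2) ≤ m ^ (1 - α₁ / 2) * u ^ (1 - α₁ / 2) := by
    rw [← Real.mul_rpow hm0.le hu0.le]
    exact (Real.rpow_le_rpow_of_exponent_ge hx0 hx1 (by linarith)).trans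
      (Real.rpow_le_rpow hx0.le hxu (by linarith))
  have h4 : u ^ (1 - α₁ / 2) * u ^ (α₁ / 2) = u := by
    rw [← Real.rpow_add hu0]; simp
  have hc0 : 0 < c₂ := by linarith
  have h5 : V a * V b / V r ^ 2 ≤ c₂ ^ 2 * (x ^ (α₁ / 2) * u ^ (α₁ / 2)) := by
    rw [div_le_iff₀ (by positivity)]
    calc V a * V b ≤ (c₂ * x ^ (α₁ / 2) * V r) * (c₂ * u ^ (α₁ / 2) * V r) := by gcongr
      _ = _ := by ring
  calc V a * V b / V r ^ 2 * (w / b)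
      ≤ c₂ ^ 2 * (x ^ (α₁ / 2) * u ^ (α₁ / 2)) * u⁻¹ := by gcongr
    _ ≤ c₂ ^ 2 * ((m ^ (1 - α₁ / 2) * u ^ (1 - α₁ / 2)) * u ^ (α₁ / 2)) * u⁻¹ := by gcongr
    _ = c₂ ^ 2 * m ^ (1 - α₁ / 2) := by
      rw [mul_assoc (m ^ _), h4]; field_simp

end
end

section
/- Let d ≥ 2 and let D ⊆ ℝ^d be a nonempty bounded open set. Let V : [0,∞) → [0,∞) be nondecreasing with V(0)=0, V(r) > 0 for r > 0, and suppose there are constants c₂ ≥ 1 and α₁ with 1 < α₁ < 2 such that V(ηr) ≤ c₂ η^{α₁/2} V(r) for all 0 < η ≤ 1 and 0 < r ≤ diam(D). Let m ≥ 1 and define U(s) = V(s)²/s^d and H(y,z) = U(|y−z|) · ( V(δ_D(y)) V(δ_D(z)) / V(r(y,z))² ) · ( (δ_D(z) ∨ |y−z|) / (|y−z| δ_D(z)) ). Then for all y, z ∈ D with y ≠ z and δ_D(y) ≤ m·δ_D(z): H(y,z) ≤ c₂⁴ · m^{1 − α₁/2} · V(diam(D))² · diam(D)^{−α₁} · |y−z|^{α₁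 − d − 1}. In particular, for each R > 0 the set {z ∈ D : δ_D(y) ≤ m·δ_D(z) and H(y,z) > R} is contained in a ball about y of radius c·R^{−1/(d+1−α₁)} with c independent of y and R. -/
open Metric MeasureTheory Filter Set

noncomputable section

theorem aux_key (a b t r c p m A B W : ℝ) (ha : 0 < a) (hb : 0 < b) (ht : 0 < t)
    (har : a ≤ r) (hbr : b ≤ r) (htr : t ≤ r) (hc : 1 ≤ c) (hp : 1 / 2 < p) (hp1 : p < 1)
    (hm : 1 ≤ m) (hab : a ≤ m * b) (hA : 0 < A) (hB : 0 < B) (hW : 0 < W)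
    (hAW : A ≤ W) (hBW : B ≤ W)
    (hA' : A ≤ c * (a / r) ^ p * W) (hB' : B ≤ c * (b / r) ^ p * W) :
    A * B / W ^ 2 * (max b t / (t * b)) ≤ c ^ 2 * m ^ (1 - p) / t := by
  have hr : 0 < r := ha.trans_le har
  have hmp : 1 ≤ m ^ (1 - p) := Real.one_le_rpow hm (by linarith)
  have hc2 : 1 ≤ c ^ 2 := one_le_pow₀ hc
  rcases le_total t b with h | h
  · rw [max_eq_left h]
    have e : b / (t * b) = 1 / t := by field_simp
    rw [e, mul_one_div]
    have : A * B / W ^ 2 ≤ 1 := by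
      rw [div_le_one (by positivity)]
      nlinarith
    have h2 : 1 ≤ c ^ 2 * m ^ (1 - p) := by nlinarith
    gcongr
    linarith
  · rw [max_eq_right h]
    have e : t / (t * b) = 1 / b := by field_simp
    rw [e, mul_one_div]
    have hx : 0 < a / r := by positivity
    have hy : 0 < b / r := by positivity
    have hx1 : a / r ≤ 1 := by rw [div_le_one hr]; exact har
    have h1 : (a / r) ^ p ≤ (a / r) ^ (1 - p) :=
      Real.rpow_le_rpow_of_exponent_ge hx hx1 (by linarith)
    have h2 : (a / r) ^ (1 - p) ≤ (m * (b / r)) ^ (1 - p) := by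
      apply Real.rpow_le_rpow hx.le _ (by linarith)
      rw [← mul_div_assoc]; gcongr
    rw [Real.mul_rpow (by linarith) hy.le] at h2
    have h3 : (b / r) ^ (1 - p) * (b / r) ^ p = b / r := by
      rw [← Real.rpow_add hy]; simp
    have h4 : (a / r) ^ p * (b / r) ^ p ≤ m ^ (1 - p) * (b / r) := by
      calc _ ≤ (m ^ (1 - p) * (b / r) ^ (1 - p)) * (b / r) ^ p := by
            gcongr; exact h1.trans h2
        _ = _ := by rw [mul_assoc, h3]
    have h5 : A * B / W ^ 2 ≤ c ^ 2 * (m ^ (1 - p) * (b / r)) := by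
      rw [div_le_iff₀ (by positivity)]
      calc A * B ≤ (c * (a / r) ^ p * W) * (c * (b / r) ^ p * W) := by gcongr
        _ = c ^ 2 * ((a / r) ^ p * (b / r) ^ p) * W ^ 2 := by ring
        _ ≤ _ := by gcongr
    calc A * B / W ^ 2 / b ≤ c ^ 2 * (m ^ (1 - p) * (b / r)) / b := by gcongr
      _ = c ^ 2 * m ^ (1 - p) / r := by field_simp
      _ ≤ _ := by gcongr

theorem aux_delta_pos {d : ℕ} (hd : 2 ≤ d) (D : Set (EuclideanSpace ℝ (Fin d)))
    (hDopen : IsOpen D) (hDbdd : Bornology.IsBounded D)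
    (y : EuclideanSpace ℝ (Fin d)) (hy : y ∈ D) :
    0 < deltaD D y ∧ deltaD D y ≤ Metric.diam D := by
  haveI : Nonempty (Fin d) := ⟨⟨0, by omega⟩⟩
  have hne : (Dᶜ).Nonempty := by
    by_contra h
    rw [Set.not_nonempty_iff_eq_empty, Set.compl_empty_iff] at h
    rw [h] at hDbdd
    exact NormedSpace.unbounded_univ ℝ (EuclideanSpace ℝ (Fin d)) hDbdd
  have hpos : 0 < deltaD D y :=
    (hDopen.isClosed_compl.notMem_iff_infDist_pos hne).1 (by simpa using hy)
  refine ⟨hpos, ?_⟩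
  apply le_of_forall_lt_imp_le_of_dense
  intro s hs
  rcases le_or_gt s 0 with h0 | h0
  · exact h0.trans Metric.diam_nonneg
  obtain ⟨v, hv⟩ := exists_norm_eq (EuclideanSpace ℝ (Fin d)) h0.le
  have hmem : y + v ∈ D := by
    by_contra hn
    have := Metric.infDist_le_dist_of_mem (x := y) (s := Dᶜ) hn
    rw [dist_self_add_right, hv] at this
    exact absurd hs (not_lt.2 this)
  have := Metric.dist_le_diam_of_mem hDbdd hy hmem
  rwa [dist_self_add_right, hv] at this

/-- Estimates (3.8)–(3.9): bound for `H(y,z)` on `{δ_D(y) ≤ m δ_D(z)}`, and the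
resulting localization of the level sets `A_R(y)`. -/
theorem H_level_set_localization {d : ℕ} (hd : 2 ≤ d)
    (D : Set (EuclideanSpace ℝ (Fin d))) (hDne : D.Nonempty) (hDopen : IsOpen D)
    (hDbdd : Bornology.IsBounded D)
    (V : ℝ → ℝ)
    (hVmono : ∀ r s : ℝ, 0 ≤ r → r ≤ s → V r ≤ V s)
    (hV0 : V 0 = 0)
    (hVpos : ∀ r : ℝ, 0 < r → 0 < V r)
    (c₂ α₁ : ℝ) (hc₂ : 1 ≤ c₂) (hα₁ : 1 < α₁) (hα₁' : α₁ < 2)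
    (hVscal : ∀ η r : ℝ, 0 < η → η ≤ 1 → 0 < r → r ≤ Metric.diam D →
      V (η * r) ≤ c₂ * η ^ (α₁ / 2) * V r)
    (m : ℝ) (hm : 1 ≤ m) :
    (∀ y z : EuclideanSpace ℝ (Fin d), y ∈ D → z ∈ D → y ≠ z →
      deltaD D y ≤ m * deltaD D z →
      HQfun V D y z ≤
        c₂ ^ 4 * m ^ (1 - α₁ / 2) * (V (Metric.diam D)) ^ 2 *
          (Metric.diam D) ^ (-α₁) * (dist y z) ^ (α₁ - d - 1)) ∧
    ∃ c : ℝ, 0 < c ∧ ∀ y ∈ D, ∀ R : ℝ, 0 < R →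
      {z | z ∈ D ∧ deltaD D y ≤ m * deltaD D z ∧ R < HQfun V D y z} ⊆
        Metric.closedBall y (c * R ^ (-(1 / ((d : ℝ) + 1 - α₁)))) := by
  have hscal : ∀ s r : ℝ, 0 < s → s ≤ r → r ≤ Metric.diam D →
      V s ≤ c₂ * (s / r) ^ (α₁ / 2) * V r := by
    intro s r hs hsr hr
    have hr0 : 0 < r := hs.trans_le hsr
    have := hVscal (s / r) r (by positivity) (by rw [div_le_one hr0]; exact hsr) hr0 hr
    rwa [div_mul_cancel₀ _ hr0.ne'] at this
  have hmain : ∀ y z : EuclideanSpace ℝ (Fin d), y ∈ D → z ∈ D → y ≠ z →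
      deltaD D y ≤ m * deltaD D z →
      HQfun V D y z ≤
        c₂ ^ 4 * m ^ (1 - α₁ / 2) * (V (Metric.diam D)) ^ 2 *
          (Metric.diam D) ^ (-α₁) * (dist y z) ^ (α₁ - d - 1) := by
    intro y z hy hz hyz hm'
    obtain ⟨ha, haL⟩ := aux_delta_pos hd D hDopen hDbdd y hy
    obtain ⟨hb, hbL⟩ := aux_delta_pos hd D hDopen hDbdd z hz
    have ht : 0 < dist y z := dist_pos.2 hyz
    have htL : dist y z ≤ Metric.diam D := Metric.dist_le_diam_of_mem hDbdd hy hz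
    have har : deltaD D y ≤ rD D y z := (le_max_left _ _).trans (le_max_left _ _)
    have hbr : deltaD D z ≤ rD D y z := (le_max_right _ _).trans (le_max_left _ _)
    have htr : dist y z ≤ rD D y z := le_max_right _ _
    have hrL : rD D y z ≤ Metric.diam D := max_le (max_le haL hbL) htL
    have hk := aux_key _ _ _ _ c₂ (α₁ / 2) m _ _ _ ha hb ht har hbr htr hc₂ (by linarith)
      (by linarith) hm hm' (hVpos _ ha) (hVpos _ hb) (hVpos _ (ha.trans_le har))
      (hVmono _ _ ha.le har) (hVmono _ _ hb.le hbr)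
      (hscal _ _ ha har hrL) (hscal _ _ hb hbr hrL)
    have hVt := hscal _ _ ht htL le_rfl
    unfold HQfun Ufun
    generalize dist y z = t at *
    generalize Metric.diam D = L at *
    have hL : 0 < L := ht.trans_le htL
    have hVt0 := hVpos t ht
    have hVL0 := hVpos L hL
    rw [mul_assoc]
    have e1 : ((t / L) ^ (α₁ / 2)) ^ 2 = t ^ α₁ * L ^ (-α₁) := by
      rw [← Real.rpow_natCast, ← Real.rpow_mul (by positivity), Real.div_rpow ht.le hL.le,
        Real.rpow_neg hL.le]
      norm_num
      rfl
    have e2 : t ^ (α₁ - d - 1) = t ^ α₁ / t ^ d / t := by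
      rw [Real.rpow_sub ht, Real.rpow_sub ht, Real.rpow_natCast, Real.rpow_one]
    calc _ ≤ (c₂ * (t / L) ^ (α₁ / 2) * V L) ^ 2 / t ^ d * (c₂ ^ 2 * m ^ (1 - α₁ / 2) / t) := by
          have hnn : 0 ≤ V (deltaD D y) * V (deltaD D z) / V (rD D y z) ^ 2 *
              (max (deltaD D z) t / (t * deltaD D z)) := by
            have h1 := hVpos _ ha
            have h2 := hVpos _ hb
            have h3 : 0 < max (deltaD D z) t := lt_max_of_lt_right ht
            positivity
          gcongr
      _ = _ := by
          rw [mul_pow, mul_pow, e1, e2]; ring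
  refine ⟨hmain, ?_⟩
  obtain ⟨x, hx⟩ := hDne
  have hL : 0 < Metric.diam D := by
    obtain ⟨h1, h2⟩ := aux_delta_pos hd D hDopen hDbdd x hx
    linarith
  have hVL := hVpos _ hL
  set K := c₂ ^ 4 * m ^ (1 - α₁ / 2) * (V (Metric.diam D)) ^ 2 *
          (Metric.diam D) ^ (-α₁) with hK
  have hKpos : 0 < K := by positivity
  have hd' : (2 : ℝ) ≤ d := by exact_mod_cast hd
  set q := (d : ℝ) + 1 - α₁ with hq
  have hqpos : 0 < q := by linarith
  refine ⟨K ^ (1 / q), by positivity, ?_⟩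
  rintro y hy R hR z ⟨hz, hmz, hRH⟩
  have hyz : y ≠ z := by
    rintro rfl
    simp [HQfun] at hRH
    linarith
  have ht : 0 < dist y z := dist_pos.2 hyz
  have h := hRH.trans_le (hmain y z hy hz hyz hmz)
  rw [Metric.mem_closedBall, dist_comm]
  have e : α₁ - d - 1 = -q := by rw [hq]; ring
  rw [e, Real.rpow_neg ht.le, ← div_eq_mul_inv, lt_div_iff₀ (by positivity)] at h
  have h2 : dist y z ^ q ≤ K / R := by
    rw [le_div_iff₀ hR]; linarith
  have h3 := Real.rpow_le_rpow (by positivity) h2 (show 0 ≤ 1 / q by positivity)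
  rw [← Real.rpow_mul ht.le, mul_one_div_cancel hqpos.ne', Real.rpow_one,
    Real.div_rpow hKpos.le hR.le] at h3
  rw [Real.rpow_neg hR.le, ← div_eq_mul_inv]
  exact h3

end
end
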